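/- arXiv:1601.04953 — 3 statements merged into one kernel-verified Lean document; each statement's English description precedes it below -/
import Mathlib

section
/- Let $a, b > 0$, $T > 0$, and let $f : [0,T] \to [0,\infty)$ be continuous and satisfy $f(t) \le f(0) + \int_0^t \big( a f(s) + b \big)^5\, ds$ for all $t \in [0,T]$. Then for every $t \in [0,T]$ with $t < \dfrac{1}{4a\,(a f(0) + b)^4}$ one has $f(t) \le \dfrac{a f(0) + b}{a \big( 1 - 4 a t\, (a f(0) + b)^4 \big)^{1/4}} - \dfrac{b}{a}$. -/
open Real

/-- A positive subsolution of `g' = a g⁵` satisfies `g(0)⁻⁴ - 4 a t ≤ g(t)⁻⁴`. -/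
theorem inv_pow_four_sub_le_of_hasDerivAt_le {a T : ℝ} {g g' : ℝ → ℝ}
    (hgc : ContinuousOn g (Set.Icc 0 T)) (hgpos : ∀ t ∈ Set.Icc 0 T, 0 < g t)
    (hg : ∀ t ∈ Set.Ioo 0 T, HasDerivAt g (g' t) t)
    (hle : ∀ t ∈ Set.Ioo 0 T, g' t ≤ a * g t ^ 5) {t : ℝ} (ht : t ∈ Set.Icc 0 T) :
    (g 0 ^ 4)⁻¹ - 4 * a * t ≤ (g t ^ 4)⁻¹ := by
  have hmono : MonotoneOn (fun s => (g s ^ 4)⁻¹ + 4 * a * s) (Set.Icc 0 T) := by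
    refine monotoneOn_of_hasDerivWithinAt_nonneg (convex_Icc 0 T)
      (f' := fun s => -(4 * g s ^ 3 * g' s) / (g s ^ 4) ^ 2 + 4 * a) ?_ ?_ ?_
    · exact ((hgc.pow 4).inv₀ fun s hs => (pow_pos (hgpos s hs) 4).ne').add (by fun_prop)
    · intro s hs
      rw [interior_Icc] at hs
      have hpos := hgpos s (Set.Ioo_subset_Icc_self hs)
      have hd := (((hg s hs).fun_pow 4).fun_inv (pow_pos hpos 4).ne').fun_add
        ((hasDerivAt_id s).const_mul (4 * a))
      simpa using hd.hasDerivWithinAt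
    · intro s hs
      rw [interior_Icc] at hs
      have hpos := hgpos s (Set.Ioo_subset_Icc_self hs)
      have heq : -(4 * g s ^ 3 * g' s) / (g s ^ 4) ^ 2 + 4 * a
          = 4 * (a * g s ^ 5 - g' s) / g s ^ 5 := by
        field_simp
        ring
      have := sub_nonneg.2 (hle s hs)
      rw [heq]
      positivity
  have h := hmono (Set.left_mem_Icc.2 (ht.1.trans ht.2)) ht ht.1
  simp only [mul_zero, add_zero] at h
  linarith

/-- Solving `x⁻⁴ - c ≤ y⁻⁴` for `y`. -/
theorem le_div_rpow_of_inv_pow_four_sub_le {x y c : ℝ} (hx : 0 < x) (hy : 0 < y)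
    (hc : 0 < 1 - c * x ^ 4) (h : (x ^ 4)⁻¹ - c ≤ (y ^ 4)⁻¹) :
    y ≤ x / (1 - c * x ^ 4) ^ ((1 : ℝ) / 4) := by
  have hr := rpow_pos_of_pos hc ((1 : ℝ) / 4)
  rw [le_div_iff₀ hr]
  refine le_of_pow_le_pow_left₀ (n := 4) (by norm_num) hx.le ?_
  have hr4 : ((1 - c * x ^ 4) ^ ((1 : ℝ) / 4)) ^ 4 = 1 - c * x ^ 4 := by
    rw [← rpow_natCast, ← rpow_mul hc.le]
    norm_num
  rw [mul_pow, hr4]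
  calc y ^ 4 * (1 - c * x ^ 4) = y ^ 4 * x ^ 4 * ((x ^ 4)⁻¹ - c) := by field_simp
    _ ≤ y ^ 4 * x ^ 4 * (y ^ 4)⁻¹ := by gcongr
    _ = x ^ 4 := by field_simp

/-- Gronwall-type estimate for the integral inequality `f(t) ≤ f(0) + ∫₀ᵗ (a f(s) + b)⁵ ds`:
up to the blowup time of the comparison ODE `g' = (a g + b)⁵`, one has
`f(t) ≤ (a f(0) + b) / (a (1 - 4 a t (a f(0) + b)⁴)^{1/4}) - b/a`. -/
theorem gronwall_quintic
    (a b T : ℝ) (ha : 0 < a) (hb : 0 < b) (hT : 0 < T)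
    (f : ℝ → ℝ)
    (hfc : ContinuousOn f (Set.Icc 0 T))
    (hfnn : ∀ t ∈ Set.Icc 0 T, 0 ≤ f t)
    (hineq : ∀ t ∈ Set.Icc 0 T, f t ≤ f 0 + ∫ s in (0:ℝ)..t, (a * f s + b) ^ 5) :
    ∀ t ∈ Set.Icc 0 T, t < 1 / (4 * a * (a * f 0 + b) ^ 4) →
      f t ≤ (a * f 0 + b) / (a * (1 - 4 * a * t * (a * f 0 + b) ^ 4) ^ ((1:ℝ)/4)) - b / a := by
  intro t ht htlt
  have h0 : (0 : ℝ) ∈ Set.Icc 0 T := Set.left_mem_Icc.2 hT.le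
  have hA : 0 < a * f 0 + b := by have := hfnn 0 h0; positivity
  have hcont : ContinuousOn (fun s => (a * f s + b) ^ 5) (Set.Icc 0 T) := by fun_prop
  have hint : ∀ s ∈ Set.Icc 0 T,
      IntervalIntegrable (fun s => (a * f s + b) ^ 5) MeasureTheory.volume 0 s := fun s hs =>
    (hcont.mono (Set.Icc_subset_Icc_right hs.2)).intervalIntegrable_of_Icc hs.1
  set G : ℝ → ℝ := fun t => (a * f 0 + b) + a * ∫ s in (0:ℝ)..t, (a * f s + b) ^ 5 with hG
  have hG0 : G 0 = a * f 0 + b := by simp [hG]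
  have hle : ∀ s ∈ Set.Icc 0 T, a * f s + b ≤ G s := fun s hs => by
    have := mul_le_mul_of_nonneg_left (hineq s hs) ha.le
    simp only [hG]
    linarith
  have hpos : ∀ s ∈ Set.Icc 0 T, 0 < a * f s + b := fun s hs => by
    have := hfnn s hs
    positivity
  have hGpos : ∀ s ∈ Set.Icc 0 T, 0 < G s := fun s hs => (hpos s hs).trans_le (hle s hs)
  have hGc : ContinuousOn G (Set.Icc 0 T) := by
    have h := intervalIntegral.continuousOn_primitive_interval' (hint T ⟨hT.le, le_rfl⟩)
      Set.left_mem_uIcc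
    rw [Set.uIcc_of_le hT.le] at h
    exact continuousOn_const.add (continuousOn_const.mul h)
  have hGd : ∀ s ∈ Set.Ioo 0 T, HasDerivAt G (a * (a * f s + b) ^ 5) s := fun s hs => by
    have hc := hcont.mono Set.Ioo_subset_Icc_self
    exact ((intervalIntegral.integral_hasDerivAt_right (hint s (Set.Ioo_subset_Icc_self hs))
      (hc.stronglyMeasurableAtFilter isOpen_Ioo s hs)
      (hc.continuousAt (isOpen_Ioo.mem_nhds hs))).const_mul a).const_add _
  have hsub := inv_pow_four_sub_le_of_hasDerivAt_le (a := a) hGc hGpos hGd (fun s hs => by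
    have hs' := Set.Ioo_subset_Icc_self hs
    have := (hpos s hs').le
    gcongr
    exact hle s hs') ht
  rw [hG0] at hsub
  have hc : 0 < 1 - 4 * a * t * (a * f 0 + b) ^ 4 := by
    rw [lt_div_iff₀ (by positivity)] at htlt
    linarith
  have hbound := (hle t ht).trans (le_div_rpow_of_inv_pow_four_sub_le hA (hGpos t ht) hc hsub)
  rw [mul_comm a (_ ^ _), ← div_div, ← sub_div, le_div_iff₀ ha]
  linarith
end

section
/- Let $u : [a,b] \times \mathbb{R}^3 \to \mathbb{R}^3$ be a smooth solution of the diffusive Burgers equations, $2\pi$-periodic in every spatial coordinate. Then for all $t \in [a,b]$, $\int_{[0,2\pi]^3} |u(t,x)|^2 dx + \int_a^t \int_{[0,2\pi]^3} |\nabla u(s,x)|^2\, dx\, ds \le \int_{[0,2\pi]^3} |u(a,x)|^2 dx + \int_a^t \Big( \sup_{x} |u(s,x)| \Big)^2 \int_{[0,2\pi]^3} |u(s,x)|^2 dx\, ds$, where $|\nabla u|^2 = \sum_{i,j=1}^3 (\partial_j u_i)^2$. -/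
open Real MeasureTheory

/-- The `j`-th spatial partial derivative of a scalar function on `ℝ³`. -/
noncomputable def pd (j : Fin 3) (f : (Fin 3 → ℝ) → ℝ) (x : Fin 3 → ℝ) : ℝ :=
  fderiv ℝ f x (Pi.single j 1)

/-- The Laplacian of a scalar function on `ℝ³`. -/
noncomputable def lap (f : (Fin 3 → ℝ) → ℝ) (x : Fin 3 → ℝ) : ℝ :=
  ∑ j : Fin 3, pd j (fun y => pd j f y) x

/-- The fundamental periodicity cell `[0,2π]³`. -/
def box : Set (Fin 3 → ℝ) := Set.Icc (0 : Fin 3 → ℝ) (fun _ => 2 * Real.pi)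

open scoped ContDiff

/-- A function that is `2π`-periodic in every coordinate takes all of its values on `box`. -/
theorem exists_mem_box_eq_of_periodic {α : Type*} {f : (Fin 3 → ℝ) → α}
    (hf : ∀ x j, f (x + Pi.single j (2 * Real.pi)) = f x) (x : Fin 3 → ℝ) :
    ∃ y ∈ box, f y = f x := by
  have hz (n : Fin 3 → ℤ) (x : Fin 3 → ℝ) :
      f (x + ∑ j, n j • (Pi.single j (2 * Real.pi) : Fin 3 → ℝ)) = f x := by
    have hp (j : Fin 3) : Function.Periodic f (Pi.single j (2 * Real.pi)) := fun x => hf x j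
    rw [Fin.sum_univ_three, ← add_assoc, ← add_assoc, (hp 2).zsmul (n 2), (hp 1).zsmul (n 1),
      (hp 0).zsmul (n 0)]
  have h0 : (0 : ℝ) < 2 * Real.pi := by positivity
  refine ⟨fun i => toIcoMod h0 0 (x i), ?_, ?_⟩
  · have hmem (i : Fin 3) := toIcoMod_mem_Ico h0 0 (x i)
    exact ⟨fun i => (hmem i).1, fun i => (hmem i).2.le.trans_eq (zero_add _)⟩
  · rw [← hz (fun j => toIcoDiv h0 0 (x j))]
    congr 1
    ext i
    simp [Pi.single_apply]

theorem isCompact_box : IsCompact box := isCompact_Icc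

theorem iSup_eq_sSup_image_box {f : (Fin 3 → ℝ) → ℝ}
    (hf : ∀ x j, f (x + Pi.single j (2 * Real.pi)) = f x) : ⨆ x, f x = sSup (f '' box) := by
  rw [iSup]
  congr 1
  ext r
  constructor
  · rintro ⟨x, rfl⟩
    exact exists_mem_box_eq_of_periodic hf x
  · rintro ⟨x, -, rfl⟩
    exact ⟨x, rfl⟩

theorem bddAbove_range_of_periodic {f : (Fin 3 → ℝ) → ℝ} (hc : Continuous f)
    (hf : ∀ x j, f (x + Pi.single j (2 * Real.pi)) = f x) : BddAbove (Set.range f) := by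
  refine (isCompact_box.bddAbove_image hc.continuousOn).mono ?_
  rintro _ ⟨x, rfl⟩
  exact exists_mem_box_eq_of_periodic hf x

theorem pd_add_single_of_periodic {f : (Fin 3 → ℝ) → ℝ}
    (hf : ∀ x j, f (x + Pi.single j (2 * Real.pi)) = f x) (k : Fin 3) (x : Fin 3 → ℝ) (j : Fin 3) :
    pd k f (x + Pi.single j (2 * Real.pi)) = pd k f x := by
  rw [pd, pd, ← fderiv_comp_add_right]
  simp only [hf]

theorem ContDiff.pd_param {E : Type*} [NormedAddCommGroup E] [NormedSpace ℝ E]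
    {w : E → (Fin 3 → ℝ) → ℝ}
    (hw : ContDiff ℝ ∞ (fun p : E × (Fin 3 → ℝ) => w p.1 p.2)) (j : Fin 3) :
    ContDiff ℝ ∞ (fun p : E × (Fin 3 → ℝ) => pd j (w p.1) p.2) := by
  have hw' : ContDiff ℝ ∞ (Function.uncurry fun (p : E × (Fin 3 → ℝ)) y => w p.1 y) :=
    hw.comp (contDiff_fst.fst.prodMk contDiff_snd)
  exact (hw'.fderiv (n := ∞) contDiff_snd (by simp)).clm_apply contDiff_const

theorem ContDiff.pd {f : (Fin 3 → ℝ) → ℝ} (hf : ContDiff ℝ ∞ f) (j : Fin 3) :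
    ContDiff ℝ ∞ (pd j f) := by
  have h : ContDiff ℝ ∞ (fun p : ℝ × (Fin 3 → ℝ) => f p.2) := hf.comp contDiff_snd
  exact (ContDiff.pd_param (w := fun _ => f) h j).comp
    (contDiff_const (c := (0 : ℝ)).prodMk contDiff_id)

theorem ContDiff.deriv_param {E : Type*} [NormedAddCommGroup E] [NormedSpace ℝ E]
    {w : ℝ → E → ℝ} (hw : ContDiff ℝ ∞ (fun p : ℝ × E => w p.1 p.2)) :
    ContDiff ℝ ∞ (fun p : ℝ × E => deriv (fun s => w s p.2) p.1) := by
  have hw' : ContDiff ℝ ∞ (Function.uncurry fun (p : ℝ × E) s => w s p.2) :=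
    hw.comp (contDiff_snd.prodMk contDiff_fst.snd)
  exact (hw'.fderiv (n := ∞) contDiff_fst (by simp)).clm_apply contDiff_const

/-- The divergence of a smooth periodic field has mean zero. -/
theorem integral_box_sum_pd_eq_zero {F : Fin 3 → (Fin 3 → ℝ) → ℝ} (hF : ∀ j, ContDiff ℝ ∞ (F j))
    (hper : ∀ k x j, F k (x + Pi.single j (2 * Real.pi)) = F k x) :
    ∫ x in box, ∑ j, pd j (F j) x = 0 := by
  have hle : (0 : Fin 3 → ℝ) ≤ fun _ => 2 * Real.pi := fun _ => by
    simp only [Pi.zero_apply]; positivity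
  have h := integral_divergence_of_hasFDerivAt_off_countable' (n := 2) (E := ℝ)
    0 (fun _ => 2 * Real.pi) hle F (fun j => fderiv ℝ (F j)) ∅ Set.countable_empty
    (fun j => (hF j).continuous.continuousOn)
    (fun x _ j => ((hF j).differentiable (by simp) x).hasFDerivAt)
    ((continuous_finsetSum _ fun j _ => ((hF j).pd j).continuous).continuousOn.integrableOn_compact
      isCompact_box)
  refine h.trans (Finset.sum_eq_zero fun j _ => sub_eq_zero.2 ?_)
  congr 1
  ext x
  refine Eq.trans (congrArg (F j) ?_) (hper j (j.insertNth 0 x) j)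
  ext k
  refine Fin.succAboveCases j ?_ (fun l => ?_) k <;> simp

theorem pd_mul {f g : (Fin 3 → ℝ) → ℝ} {x : Fin 3 → ℝ} (hf : DifferentiableAt ℝ f x)
    (hg : DifferentiableAt ℝ g x) (j : Fin 3) :
    pd j (fun y => f y * g y) x = f x * pd j g x + g x * pd j f x := by
  simp [pd, fderiv_fun_mul hf hg]

theorem pd_sum {ι : Type*} [Fintype ι] {f : ι → (Fin 3 → ℝ) → ℝ} {x : Fin 3 → ℝ}
    (hf : ∀ i, DifferentiableAt ℝ (f i) x) (j : Fin 3) :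
    pd j (fun y => ∑ i, f i y) x = ∑ i, pd j (f i) x := by
  simp [pd, fderiv_fun_sum fun i _ => hf i]

/-- Green's identity on the torus, with `v` paired with its own Laplacian. -/
theorem integral_box_mul_lap_add_sq_eq_zero {v : (Fin 3 → ℝ) → (Fin 3 → ℝ)}
    (hv : ContDiff ℝ ∞ v) (hper : ∀ x j, v (x + Pi.single j (2 * Real.pi)) = v x) :
    ∫ x in box, ∑ i, (v x i * lap (fun y => v y i) x + ∑ j, (pd j (fun y => v y i) x) ^ 2) = 0 := by
  have hvi (i : Fin 3) : ContDiff ℝ ∞ (fun y => v y i) := contDiff_pi.1 hv i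
  have hd {f : (Fin 3 → ℝ) → ℝ} (hf : ContDiff ℝ ∞ f) : Differentiable ℝ f :=
    hf.differentiable (by simp)
  have hpd (k i : Fin 3) (x : Fin 3 → ℝ) (j : Fin 3) :
      pd k (fun y => v y i) (x + Pi.single j (2 * Real.pi)) = pd k (fun y => v y i) x :=
    pd_add_single_of_periodic (f := fun y => v y i) (fun x j => by rw [hper]) k x j
  have hF (j i : Fin 3) : ContDiff ℝ ∞ (fun x => v x i * pd j (fun y => v y i) x) :=
    (hvi i).mul ((hvi i).pd j)
  rw [← integral_box_sum_pd_eq_zero (F := fun j x => ∑ i, v x i * pd j (fun y => v y i) x)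
    (fun j => ContDiff.sum fun i _ => hF j i)
    (fun k x j => by simp only [hper, hpd])]
  congr 1
  ext x
  have h (j : Fin 3) : pd j (fun x => ∑ i, v x i * pd j (fun y => v y i) x) x
      = ∑ i, (v x i * pd j (fun y => pd j (fun y => v y i) y) x
        + pd j (fun y => v y i) x ^ 2) := by
    rw [pd_sum fun i => hd (hF j i) x]
    refine Finset.sum_congr rfl fun i _ => ?_
    rw [pd_mul (hd (hvi i) x) (hd ((hvi i).pd j) x), sq]
  simp only [h, lap]
  rw [Finset.sum_comm]
  simp only [Finset.mul_sum, Finset.sum_add_distrib]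

theorem integral_box_sub_eq_intervalIntegral {w : ℝ → (Fin 3 → ℝ) → ℝ}
    (hw : ContDiff ℝ ∞ (fun p : ℝ × (Fin 3 → ℝ) => w p.1 p.2)) (a t : ℝ) :
    (∫ x in box, w t x) - ∫ x in box, w a x
      = ∫ s in a..t, ∫ x in box, deriv (fun r => w r x) s := by
  have hd : Continuous (fun p : ℝ × (Fin 3 → ℝ) => deriv (fun r => w r p.2) p.1) :=
    hw.deriv_param.continuous
  have hslice (x : Fin 3 → ℝ) : ContDiff ℝ ∞ (fun r => w r x) :=
    hw.comp (contDiff_id.prodMk contDiff_const)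
  have hint (s : ℝ) : IntegrableOn (w s) box :=
    (hw.continuous.comp (Continuous.prodMk_right s)).continuousOn.integrableOn_compact isCompact_box
  rw [intervalIntegral_integral_swap, ← integral_sub (hint t) (hint a)]
  · congr 1
    ext x
    refine (intervalIntegral.integral_eq_sub_of_hasDerivAt (f := fun r => w r x)
      (fun s _ => ((hslice x).differentiable (by simp) s).hasDerivAt) ?_).symm
    exact (hd.comp (Continuous.prodMk_left x)).intervalIntegrable _ _
  · rw [Measure.prod_restrict]
    refine IntegrableOn.mono_set (t := Set.uIcc a t ×ˢ box) ?_
      (Set.prod_mono Set.uIoc_subset_uIcc subset_rfl)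
    exact hd.continuousOn.integrableOn_compact (isCompact_uIcc.prod isCompact_box)

/-- Pointwise bound on the convection term by Young's inequality. -/
theorem convection_add_sq_le (v : Fin 3 → ℝ) (L : Fin 3 → ℝ) (D : Fin 3 → Fin 3 → ℝ) :
    (∑ i, 2 * v i * (L i - ∑ j, v j * D i j)) + ∑ i, ∑ j, D i j ^ 2
      ≤ 2 * (∑ i, (v i * L i + ∑ j, D i j ^ 2)) + (∑ i, v i ^ 2) * ∑ i, v i ^ 2 := by
  have h : 0 ≤ ∑ i, ∑ j, (D i j + v i * v j) ^ 2 := by positivity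
  have e : (∑ i, ∑ j, (D i j + v i * v j) ^ 2)
      = 2 * (∑ i, (v i * L i + ∑ j, D i j ^ 2)) + (∑ i, v i ^ 2) * (∑ i, v i ^ 2)
        - ((∑ i, 2 * v i * (L i - ∑ j, v j * D i j)) + ∑ i, ∑ j, D i j ^ 2) := by
    simp only [Fin.sum_univ_three]
    ring
  linarith

/-- `L²` energy estimate for a smooth periodic solution of the diffusive Burgers equations:
`‖u(t)‖² + ∫ₐᵗ ‖∇u‖² ≤ ‖u(a)‖² + ∫ₐᵗ ‖u(s)‖_∞² ‖u(s)‖² ds`. -/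
theorem burgers_energy_estimate
    (a b : ℝ) (u : ℝ → (Fin 3 → ℝ) → (Fin 3 → ℝ))
    (husm : ContDiff ℝ (⊤ : ℕ∞) (fun p : ℝ × (Fin 3 → ℝ) => u p.1 p.2))
    (huper : ∀ (t : ℝ) (x : Fin 3 → ℝ) (j : Fin 3), u t (x + Pi.single j (2 * Real.pi)) = u t x)
    (hueq : ∀ t ∈ Set.Icc a b, ∀ (x : Fin 3 → ℝ) (i : Fin 3),
      deriv (fun s => u s x i) t + ∑ j, u t x j * pd j (fun y => u t y i) x
        - lap (fun y => u t y i) x = 0) :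
    ∀ t ∈ Set.Icc a b,
      (∫ x in box, ∑ i, (u t x i) ^ 2)
          + ∫ s in a..t, ∫ x in box, ∑ i, ∑ j, (pd j (fun y => u s y i) x) ^ 2
        ≤ (∫ x in box, ∑ i, (u a x i) ^ 2)
            + ∫ s in a..t,
                (⨆ x : Fin 3 → ℝ, Real.sqrt (∑ i, (u s x i) ^ 2)) ^ 2 *
                  ∫ x in box, ∑ i, (u s x i) ^ 2 := by
  intro t ht
  have hw (i : Fin 3) : ContDiff ℝ ∞ (fun p : ℝ × (Fin 3 → ℝ) => u p.1 p.2 i) :=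
    contDiff_pi.1 husm i
  have hE : ContDiff ℝ ∞ (fun p : ℝ × (Fin 3 → ℝ) => ∑ i, u p.1 p.2 i ^ 2) :=
    ContDiff.sum fun i _ => (hw i).pow 2
  have hD : Continuous (fun p : ℝ × (Fin 3 → ℝ) =>
      ∑ i, ∑ j, pd j (fun y => u p.1 y i) p.2 ^ 2) :=
    continuous_finsetSum _ fun i _ => continuous_finsetSum _ fun j _ =>
      ((ContDiff.pd_param (w := fun s y => u s y i) (hw i) j).pow 2).continuous
  have hdE : Continuous (fun p : ℝ × (Fin 3 → ℝ) =>
      deriv (fun r => ∑ i, u r p.2 i ^ 2) p.1) :=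
    (ContDiff.deriv_param (w := fun s x => ∑ i, u s x i ^ 2) hE).continuous
  have hL (i : Fin 3) : Continuous (fun p : ℝ × (Fin 3 → ℝ) => lap (fun y => u p.1 y i) p.2) :=
    continuous_finsetSum _ fun j _ => (ContDiff.pd_param (w := fun s => pd j fun y => u s y i)
      (ContDiff.pd_param (w := fun s y => u s y i) (hw i) j) j).continuous
  have hslice {f : ℝ × (Fin 3 → ℝ) → ℝ} (hf : Continuous f) (s : ℝ) :
      IntegrableOn (fun x => f (s, x)) box :=
    (hf.comp (Continuous.prodMk_right s)).continuousOn.integrableOn_compact isCompact_box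
  have hsqrt : Continuous (fun p : ℝ × (Fin 3 → ℝ) => √(∑ i, u p.1 p.2 i ^ 2)) :=
    hE.continuous.sqrt
  have hsqrtper (s : ℝ) (x : Fin 3 → ℝ) (j : Fin 3) :
      √(∑ i, u s (x + Pi.single j (2 * Real.pi)) i ^ 2) = √(∑ i, u s x i ^ 2) := by rw [huper]
  have hM : Continuous (fun s => ⨆ x, √(∑ i, u s x i ^ 2)) := by
    rw [funext fun s => iSup_eq_sSup_image_box (hsqrtper s)]
    exact isCompact_box.continuous_sSup (f := fun s x => √(∑ i, u s x i ^ 2)) hsqrt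
  have hle_M (s : ℝ) (x : Fin 3 → ℝ) :
      ∑ i, u s x i ^ 2 ≤ (⨆ x, √(∑ i, u s x i ^ 2)) ^ 2 := by
    refine (Real.sqrt_le_left (Real.iSup_nonneg fun _ => Real.sqrt_nonneg _)).1 ?_
    exact le_ciSup (bddAbove_range_of_periodic (hsqrt.comp (Continuous.prodMk_right s))
      (hsqrtper s)) x
  have hcont {f : ℝ × (Fin 3 → ℝ) → ℝ} (hf : Continuous f) :
      Continuous (fun s => ∫ x in box, f (s, x)) :=
    continuous_parametric_integral_of_continuous (f := fun s x => f (s, x)) hf isCompact_box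
  have hdt (s : ℝ) (hs : s ∈ Set.Icc a b) (x : Fin 3 → ℝ) :
      deriv (fun r => ∑ i, u r x i ^ 2) s = ∑ i, 2 * u s x i *
        (lap (fun y => u s y i) x - ∑ j, u s x j * pd j (fun y => u s y i) x) := by
    have hui (i : Fin 3) : HasDerivAt (fun r => u r x i) (deriv (fun r => u r x i) s) s :=
      (((hw i).comp (contDiff_id.prodMk contDiff_const)).differentiable (by simp) s).hasDerivAt
    rw [(HasDerivAt.fun_sum fun i _ => (hui i).fun_pow 2).deriv]
    refine Finset.sum_congr rfl fun i _ => ?_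
    have := hueq s hs x i
    rw [show deriv (fun r => u r x i) s = lap (fun y => u s y i) x
      - ∑ j, u s x j * pd j (fun y => u s y i) x by linarith]
    norm_num
  have hpoint : ∀ s ∈ Set.Icc a t,
      (∫ x in box, deriv (fun r => ∑ i, u r x i ^ 2) s)
        + ∫ x in box, ∑ i, ∑ j, pd j (fun y => u s y i) x ^ 2
      ≤ (⨆ x, √(∑ i, u s x i ^ 2)) ^ 2 * ∫ x in box, ∑ i, u s x i ^ 2 := by
    intro s hs
    have hG : Continuous (fun p : ℝ × (Fin 3 → ℝ) => ∑ i, (u p.1 p.2 i *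
        lap (fun y => u p.1 y i) p.2 + ∑ j, pd j (fun y => u p.1 y i) p.2 ^ 2)) := by
      simp only [Finset.sum_add_distrib]
      exact (continuous_finsetSum _ fun i _ => (hw i).continuous.mul (hL i)).add hD
    have hgreen := integral_box_mul_lap_add_sq_eq_zero (v := u s)
      (husm.comp (contDiff_const.prodMk contDiff_id)) (huper s)
    rw [← integral_add (hslice hdE s) (hslice hD s)]
    calc _ ≤ ∫ x in box, (2 * (∑ i, (u s x i * lap (fun y => u s y i) x
              + ∑ j, pd j (fun y => u s y i) x ^ 2))
            + (⨆ x, √(∑ i, u s x i ^ 2)) ^ 2 * ∑ i, u s x i ^ 2) := by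
          refine integral_mono ((hslice hdE s).add (hslice hD s))
            (((hslice hG s).const_mul 2).add ((hslice hE.continuous s).const_mul _)) fun x => ?_
          simp only [hdt s ⟨hs.1, hs.2.trans ht.2⟩]
          refine (convection_add_sq_le _ _ fun i j => pd j (fun y => u s y i) x).trans ?_
          gcongr
          exact hle_M s x
      _ = _ := by
          rw [integral_add ((hslice hG s).const_mul 2) ((hslice hE.continuous s).const_mul _),
            integral_const_mul, integral_const_mul, hgreen]
          ring
  have hFTC := integral_box_sub_eq_intervalIntegral (w := fun s x => ∑ i, u s x i ^ 2) hE a t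
  have hmono : (∫ s in a..t, ∫ x in box, deriv (fun r => ∑ i, u r x i ^ 2) s)
        + ∫ s in a..t, ∫ x in box, ∑ i, ∑ j, pd j (fun y => u s y i) x ^ 2
      ≤ ∫ s in a..t, (⨆ x, √(∑ i, u s x i ^ 2)) ^ 2 * ∫ x in box, ∑ i, u s x i ^ 2 :=
    (intervalIntegral.integral_add ((hcont hdE).intervalIntegrable a t)
      ((hcont hD).intervalIntegrable a t)).symm.trans_le <|
    intervalIntegral.integral_mono_on ht.1
      (((hcont hdE).add (hcont hD)).intervalIntegrable a t)
      (((hM.pow 2).mul (hcont hE.continuous)).intervalIntegrable a t) hpoint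
  rw [← hFTC] at hmono
  linarith
end

section
/- Let $u_0 : \mathbb{R}^3 \to \mathbb{R}^3$ be smooth and $2\pi$-periodic in each coordinate. Then there exists a function $u : [0,\infty) \times \mathbb{R}^3 \to \mathbb{R}^3$, continuous on $[0,\infty) \times \mathbb{R}^3$ and $2\pi$-periodic in every spatial coordinate, with $u(0,\cdot) = u_0$, such that on $(0,\infty) \times \mathbb{R}^3$ the function $u$ is continuously differentiable in time, twice continuously differentiable in space, and satisfies the diffusive Burgers equations $\partial_t u_i + \sum_{j=1}^3 u_j \partial_j u_i - \Delta u_i = 0$ pointwise; that is, the Burgers equations admit a global classical solution for smooth periodic initial data. -/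
open Real MeasureTheory

open Set Filter Topology

/-- The square of the Euclidean norm on `ℝ³`. -/
def sqSum (z : Fin 3 → ℝ) : ℝ := ∑ i, z i ^ 2

lemma sqSum_nonneg (z : Fin 3 → ℝ) : 0 ≤ sqSum z := Finset.sum_nonneg fun _ _ => sq_nonneg _

@[fun_prop]
lemma continuous_sqSum : Continuous sqSum := by unfold sqSum; fun_prop

lemma sqSum_smul (r : ℝ) (z : Fin 3 → ℝ) : sqSum (r • z) = r ^ 2 * sqSum z := by
  simp [sqSum, Finset.mul_sum, mul_pow]

lemma sq_le_sqSum (z : Fin 3 → ℝ) (i : Fin 3) : z i ^ 2 ≤ sqSum z :=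
  Finset.single_le_sum (f := fun i => z i ^ 2) (fun _ _ => sq_nonneg _) (Finset.mem_univ i)

lemma abs_apply_le_one_add_sqSum (z : Fin 3 → ℝ) (i : Fin 3) : |z i| ≤ 1 + sqSum z := by
  have h1 := sq_le_sqSum z i
  rw [← sq_abs] at h1
  nlinarith [sq_nonneg (|z i| - 1)]

lemma norm_le_one_add_sqSum (z : Fin 3 → ℝ) : ‖z‖ ≤ 1 + sqSum z :=
  (pi_norm_le_iff_of_nonneg (by linarith [sqSum_nonneg z])).2 fun i => abs_apply_le_one_add_sqSum z i

lemma sqSum_le_of_norm_le_one {z : Fin 3 → ℝ} (hz : ‖z‖ ≤ 1) : sqSum z ≤ 3 := by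
  have h : ∀ i, z i ^ 2 ≤ 1 := fun i => by
    have := (norm_le_pi_norm z i).trans hz
    rw [Real.norm_eq_abs] at this
    exact (sq_le_one_iff_abs_le_one _).2 this
  simp only [sqSum, Fin.sum_univ_three]
  linarith [h 0, h 1, h 2]

lemma half_sqSum_sub_le (y d : Fin 3 → ℝ) : sqSum y / 2 - sqSum d ≤ sqSum (y - d) := by
  simp only [sqSum, Fin.sum_univ_three, Pi.sub_apply]
  nlinarith [sq_nonneg (y 0 - 2 * d 0), sq_nonneg (y 1 - 2 * d 1), sq_nonneg (y 2 - 2 * d 2)]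

lemma integrable_exp_neg_mul_sqSum {b : ℝ} (hb : 0 < b) :
    Integrable (fun z : Fin 3 → ℝ => exp (-b * sqSum z)) := by
  have := Integrable.fintype_prod (f := fun (_ : Fin 3) (v : ℝ) => exp (-b * v ^ 2))
    (μ := fun _ => volume) (fun _ => integrable_exp_neg_mul_sq hb)
  refine this.congr (ae_of_all _ fun z => ?_)
  simp only [sqSum, Finset.mul_sum]
  rw [Real.exp_sum]

lemma one_add_sqSum_le {c : ℝ} (hc : 0 < c) (hc1 : c ≤ 1) (z : Fin 3 → ℝ) :
    1 + sqSum z ≤ c⁻¹ * exp (c * sqSum z) := by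
  have h := add_one_le_exp (c * sqSum z)
  have h1 : c * (1 + sqSum z) ≤ exp (c * sqSum z) := by nlinarith
  rw [← div_eq_inv_mul, le_div_iff₀ hc]
  linarith

/-- Continuous kernels on `ℝ³` with Gaussian decay. -/
structure GaussianBounded (k : (Fin 3 → ℝ) → ℝ) : Prop where
  cont : Continuous k
  bound : ∃ C, ∀ z, |k z| ≤ C * exp (-(1 / 4) * sqSum z)

namespace GaussianBounded

variable {k : (Fin 3 → ℝ) → ℝ}

lemma exists_nonneg_bound (hk : GaussianBounded k) :
    ∃ C, 0 ≤ C ∧ ∀ z, |k z| ≤ C * exp (-(1 / 4) * sqSum z) := by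
  obtain ⟨C, hC⟩ := hk.bound
  refine ⟨C, ?_, hC⟩
  have := (abs_nonneg _).trans (hC 0)
  exact nonneg_of_mul_nonneg_left this (exp_pos _)

lemma integrable (hk : GaussianBounded k) : Integrable k := by
  obtain ⟨C, hC⟩ := hk.bound
  exact ((integrable_exp_neg_mul_sqSum (by norm_num : (0 : ℝ) < 1 / 4)).const_mul C).mono'
    hk.cont.aestronglyMeasurable (ae_of_all _ hC)

lemma integrable_norm_mul (hk : GaussianBounded k) : Integrable (fun z => ‖z‖ * |k z|) := by
  obtain ⟨C, hC0, hC⟩ := hk.exists_nonneg_bound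
  refine ((integrable_exp_neg_mul_sqSum (by norm_num : (0 : ℝ) < 1 / 8)).const_mul (8 * C)).mono'
    (by have := hk.cont; fun_prop) (ae_of_all _ fun z => ?_)
  rw [Real.norm_eq_abs, abs_of_nonneg (by positivity)]
  have h1 := (norm_le_one_add_sqSum z).trans
    (one_add_sqSum_le (c := 1 / 8) (by norm_num) (by norm_num) z)
  calc ‖z‖ * |k z| ≤ ((1 / 8 : ℝ)⁻¹ * exp (1 / 8 * sqSum z)) * (C * exp (-(1 / 4) * sqSum z)) := by
        gcongr; exact hC z
    _ = 8 * C * (exp (1 / 8 * sqSum z) * exp (-(1 / 4) * sqSum z)) := by ring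
    _ = _ := by rw [← exp_add]; ring_nf

end GaussianBounded

/-- The standard Gaussian density on `ℝ³`. -/
noncomputable def gaussKer (z : Fin 3 → ℝ) : ℝ :=
  (∫ y : Fin 3 → ℝ, exp (-(1 / 2) * sqSum y))⁻¹ * exp (-(1 / 2) * sqSum z)

@[fun_prop]
lemma continuous_gaussKer : Continuous gaussKer := by unfold gaussKer; fun_prop

lemma gaussKer_const_pos : 0 < (∫ y : Fin 3 → ℝ, exp (-(1 / 2) * sqSum y)) :=
  integral_exp_pos (integrable_exp_neg_mul_sqSum (by norm_num))

lemma gaussKer_nonneg (z : Fin 3 → ℝ) : 0 ≤ gaussKer z :=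
  mul_nonneg (inv_nonneg.2 gaussKer_const_pos.le) (exp_pos _).le

lemma integral_gaussKer : ∫ z, gaussKer z = 1 := by
  unfold gaussKer
  rw [integral_const_mul]
  exact inv_mul_cancel₀ gaussKer_const_pos.ne'

/-- A quadratically growing factor times the Gaussian density has Gaussian decay. -/
lemma gaussianBounded_mul {p : (Fin 3 → ℝ) → ℝ} (hp : Continuous p) {C : ℝ}
    (hC : ∀ z, |p z| ≤ C * (1 + sqSum z)) : GaussianBounded (fun z => p z * gaussKer z) := by
  refine ⟨by fun_prop, C * 4 * (∫ y : Fin 3 → ℝ, exp (-(1 / 2) * sqSum y))⁻¹, fun z => ?_⟩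
  have hC0 : 0 ≤ C := by
    have := (abs_nonneg _).trans (hC z)
    exact nonneg_of_mul_nonneg_left this (by linarith [sqSum_nonneg z])
  rw [abs_mul, abs_of_nonneg (gaussKer_nonneg z)]
  calc |p z| * gaussKer z ≤ (C * ((1 / 4 : ℝ)⁻¹ * exp (1 / 4 * sqSum z))) * gaussKer z := by
        gcongr
        · exact gaussKer_nonneg z
        · exact (hC z).trans (by gcongr; exact one_add_sqSum_le (by norm_num) (by norm_num) z)
    _ = C * 4 * (∫ y : Fin 3 → ℝ, exp (-(1 / 2) * sqSum y))⁻¹ *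
          (exp (1 / 4 * sqSum z) * exp (-(1 / 2) * sqSum z)) := by unfold gaussKer; ring
    _ = _ := by rw [← exp_add]; ring_nf

lemma gaussianBounded_gaussKer : GaussianBounded gaussKer := by
  simpa using gaussianBounded_mul (p := fun _ => 1) continuous_const (C := 1)
    (fun z => by simp [sqSum_nonneg z])

lemma gaussianBounded_apply_mul (j : Fin 3) : GaussianBounded (fun z => z j * gaussKer z) :=
  gaussianBounded_mul (p := fun z => z j) (by fun_prop) (C := 1)
    (fun z => by simpa using abs_apply_le_one_add_sqSum z j)

/-- The second order Hermite polynomials on `ℝ³`. -/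
noncomputable def hermiteTwo (j i : Fin 3) (z : Fin 3 → ℝ) : ℝ :=
  z i * z j - if i = j then 1 else 0

lemma gaussianBounded_hermiteTwo_mul (j i : Fin 3) :
    GaussianBounded (fun z => hermiteTwo j i z * gaussKer z) := by
  refine gaussianBounded_mul (by unfold hermiteTwo; fun_prop) (C := 1) fun z => ?_
  have h1 := sq_le_sqSum z i
  have h2 := sq_le_sqSum z j
  have h0 := sqSum_nonneg z
  unfold hermiteTwo
  rw [abs_le]
  split_ifs <;> constructor <;> nlinarith [sq_nonneg (z i + z j), sq_nonneg (z i - z j)]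

/-- The linear functional on `ℝ³` with given coefficients. -/
noncomputable def dualOf : (Fin 3 → ℝ) →L[ℝ] ((Fin 3 → ℝ) →L[ℝ] ℝ) :=
  ∑ j, (ContinuousLinearMap.proj (R := ℝ) (φ := fun _ : Fin 3 => ℝ) j).smulRight
    (ContinuousLinearMap.proj (R := ℝ) (φ := fun _ : Fin 3 => ℝ) j)

lemma dualOf_apply (c h : Fin 3 → ℝ) : dualOf c h = ∑ j, c j * h j := by
  simp [dualOf]

lemma dualOf_single (c : Fin 3 → ℝ) (j : Fin 3) : dualOf c (Pi.single j 1) = c j := by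
  simp [dualOf_apply, Pi.single_apply]

lemma hasFDerivAt_sqSum (z : Fin 3 → ℝ) : HasFDerivAt sqSum (dualOf fun j => 2 * z j) z := by
  have : ∀ i : Fin 3, HasFDerivAt (fun z : Fin 3 → ℝ => z i ^ 2)
      ((2 * z i) • ContinuousLinearMap.proj (R := ℝ) (φ := fun _ : Fin 3 => ℝ) i) z := fun i => by
    simpa using (hasFDerivAt_apply (𝕜 := ℝ) i z).pow 2
  refine (HasFDerivAt.fun_sum (u := Finset.univ) fun i _ => this i).congr_fderiv ?_
  ext h
  simp [dualOf_apply]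

lemma hasFDerivAt_gaussKer (z : Fin 3 → ℝ) :
    HasFDerivAt gaussKer (dualOf fun j => -(z j * gaussKer z)) z := by
  have h := (((hasFDerivAt_sqSum z).const_mul (-(1 / 2) : ℝ)).exp).const_mul
    (∫ y : Fin 3 → ℝ, exp (-(1 / 2) * sqSum y))⁻¹
  refine h.congr_fderiv ?_
  ext e
  simp only [smul_apply, dualOf_apply, gaussKer, smul_eq_mul, Finset.mul_sum]
  exact Finset.sum_congr rfl fun i _ => by ring

lemma hasFDerivAt_apply_mul_gaussKer (j : Fin 3) (z : Fin 3 → ℝ) :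
    HasFDerivAt (fun z => z j * gaussKer z)
      (dualOf fun i => -(hermiteTwo j i z * gaussKer z)) z := by
  have h := (hasFDerivAt_apply (𝕜 := ℝ) j z).mul (hasFDerivAt_gaussKer z)
  refine h.congr_fderiv ?_
  ext e
  fin_cases j <;> simp [dualOf_apply, hermiteTwo, Fin.sum_univ_three] <;> ring

/-- The average of `f` around `x` at scale `σ` against the kernel `k`. -/
noncomputable def heatAvg (k f : (Fin 3 → ℝ) → ℝ) (σ : ℝ) (x : Fin 3 → ℝ) : ℝ :=
  ∫ z, k z * f (x + σ • z)

section heatAvg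

variable {k f : (Fin 3 → ℝ) → ℝ} {B : ℝ}

lemma integrable_kernel_mul (hk : Integrable k) (hf : Continuous f) (hB : ∀ x, |f x| ≤ B)
    (σ : ℝ) (x : Fin 3 → ℝ) : Integrable (fun z => k z * f (x + σ • z)) :=
  hk.mul_bdd (c := B) (by fun_prop) (ae_of_all _ fun z => hB _)

lemma abs_heatAvg_le (hk : Integrable k) (hB : ∀ x, |f x| ≤ B) (σ : ℝ) (x : Fin 3 → ℝ) :
    |heatAvg k f σ x| ≤ (∫ z, |k z|) * B := by
  rw [← integral_mul_const, ← Real.norm_eq_abs]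
  unfold heatAvg
  refine norm_integral_le_of_norm_le (hk.abs.mul_const B) (ae_of_all _ fun z => ?_)
  rw [Real.norm_eq_abs, abs_mul]
  exact mul_le_mul_of_nonneg_left (hB _) (abs_nonneg _)

lemma continuous_heatAvg (hk : Integrable k) (hf : Continuous f) (hB : ∀ x, |f x| ≤ B) :
    Continuous (fun p : ℝ × (Fin 3 → ℝ) => heatAvg k f p.1 p.2) := by
  refine continuous_of_dominated (bound := fun z => |k z| * B)
    (fun p => (integrable_kernel_mul hk hf hB p.1 p.2).aestronglyMeasurable)
    (fun p => ae_of_all _ fun z => ?_) (hk.abs.mul_const B) (ae_of_all _ fun z => by fun_prop)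
  rw [Real.norm_eq_abs, abs_mul]
  exact mul_le_mul_of_nonneg_left (hB _) (abs_nonneg _)

/-- Averages of a Lipschitz function against a mean zero kernel are of the order of the scale. -/
lemma abs_heatAvg_le_of_integral_eq_zero (hk : GaussianBounded k) (h0 : ∫ z, k z = 0)
    (hf : Continuous f) (hB : ∀ x, |f x| ≤ B) {Λ : ℝ} (hΛ : ∀ x h, |f (x + h) - f x| ≤ Λ * ‖h‖)
    {σ : ℝ} (hσ : 0 ≤ σ) (x : Fin 3 → ℝ) :
    |heatAvg k f σ x| ≤ (∫ z, ‖z‖ * |k z|) * Λ * σ := by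
  have h1 : heatAvg k f σ x = ∫ z, k z * (f (x + σ • z) - f x) := by
    simp only [mul_sub]
    rw [integral_sub (integrable_kernel_mul hk.integrable hf hB σ x)
      (hk.integrable.mul_const _), integral_mul_const, h0, zero_mul, sub_zero]
    rfl
  rw [h1, mul_assoc, ← integral_mul_const, ← Real.norm_eq_abs]
  refine norm_integral_le_of_norm_le (hk.integrable_norm_mul.mul_const _)
    (ae_of_all _ fun z => ?_)
  rw [Real.norm_eq_abs, abs_mul]
  calc |k z| * |f (x + σ • z) - f x| ≤ |k z| * (Λ * ‖σ • z‖) := by gcongr; exact hΛ _ _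
    _ = _ := by rw [norm_smul, Real.norm_eq_abs, abs_of_nonneg hσ]; ring

lemma heatAvg_eq_integral_sub (k f : (Fin 3 → ℝ) → ℝ) {σ : ℝ} (hσ : σ ≠ 0) (x : Fin 3 → ℝ) :
    heatAvg k f σ x = ∫ z, k (z - σ⁻¹ • x) * f (σ • z) := by
  rw [heatAvg, ← integral_sub_right_eq_self (fun z => k z * f (x + σ • z)) (σ⁻¹ • x)]
  simp [smul_sub, smul_smul, hσ]

/-- Spatial derivatives of an average fall on the kernel. -/
lemma hasFDerivAt_heatAvg {k' : Fin 3 → (Fin 3 → ℝ) → ℝ} (hk : GaussianBounded k)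
    (hk' : ∀ j, GaussianBounded (k' j))
    (hd : ∀ z, HasFDerivAt k (dualOf fun j => -k' j z) z)
    (hf : Continuous f) (hB : ∀ x, |f x| ≤ B) {σ : ℝ} (hσ : 0 < σ) (x : Fin 3 → ℝ) :
    HasFDerivAt (heatAvg k f σ) (dualOf fun j => σ⁻¹ * heatAvg (k' j) f σ x) x := by
  choose C hC0 hC using fun j => (hk' j).exists_nonneg_bound
  have hB0 : 0 ≤ B := (abs_nonneg _).trans (hB 0)
  have hfun : heatAvg k f σ = fun x => ∫ z, k (z - σ⁻¹ • x) * f (σ • z) := by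
    funext x; exact heatAvg_eq_integral_sub k f hσ.ne' x
  have hkc := hk.cont
  have hkc' := fun j => (hk' j).cont
  have key := hasFDerivAt_integral_of_dominated_of_fderiv_le (μ := volume) (𝕜 := ℝ)
    (F := fun x z => k (z - σ⁻¹ • x) * f (σ • z))
    (F' := fun x z => dualOf fun j => σ⁻¹ * (k' j (z - σ⁻¹ • x) * f (σ • z)))
    (x₀ := x) (s := Metric.ball x σ)
    (bound := fun z => ‖dualOf‖ * (σ⁻¹ * ((∑ j, C j) * exp (3 / 4) * B) *
      exp (-(1 / 8) * sqSum (z - σ⁻¹ • x))))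
    (Metric.ball_mem_nhds x hσ)
    (Eventually.of_forall fun y => by fun_prop)
    ((hk.integrable.comp_sub_right (σ⁻¹ • x)).mul_bdd (c := B) (by fun_prop)
      (ae_of_all _ fun z => hB _))
    (dualOf.continuous.comp (continuous_pi fun j => by fun_prop)).aestronglyMeasurable
    (ae_of_all _ fun z y hy => ?_) ?_ (ae_of_all _ fun z y hy => ?_)
  · rw [hfun]
    refine key.congr_fderiv ?_
    have hint : ∀ j, Integrable (fun z => σ⁻¹ * (k' j (z - σ⁻¹ • x) * f (σ • z))) := fun j =>
      (((hk' j).integrable.comp_sub_right (σ⁻¹ • x)).mul_bdd (c := B) (by fun_prop)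
        (ae_of_all _ fun z => hB _)).const_mul _
    rw [ContinuousLinearMap.integral_comp_comm dualOf (Integrable.of_eval hint)]
    congr 1
    funext j
    rw [eval_integral (fun i => hint i), integral_const_mul,
      heatAvg_eq_integral_sub (k' j) f hσ.ne']
  · refine (dualOf.le_opNorm _).trans ?_
    refine mul_le_mul_of_nonneg_left ?_ (norm_nonneg _)
    refine (pi_norm_le_iff_of_nonneg (by
      have := Finset.sum_nonneg fun j (_ : j ∈ Finset.univ) => hC0 j
      positivity)).2 fun j => ?_
    rw [Real.norm_eq_abs, abs_mul, abs_mul, abs_of_pos (inv_pos.2 hσ)]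
    have hd1 : sqSum (σ⁻¹ • (y - x)) ≤ 3 := by
      refine sqSum_le_of_norm_le_one ?_
      rw [norm_smul, norm_inv, Real.norm_eq_abs, abs_of_pos hσ, ← div_eq_inv_mul,
        div_le_one hσ, ← dist_eq_norm]
      exact (Metric.mem_ball.1 hy).le
    have hd2 := half_sqSum_sub_le (z - σ⁻¹ • x) (σ⁻¹ • (y - x))
    have he : z - σ⁻¹ • x - σ⁻¹ • (y - x) = z - σ⁻¹ • y := by rw [smul_sub]; abel
    rw [he] at hd2
    have h3 : |k' j (z - σ⁻¹ • y)| ≤ (∑ j, C j) * exp (3 / 4) *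
        exp (-(1 / 8) * sqSum (z - σ⁻¹ • x)) := by
      refine (hC j _).trans ?_
      rw [mul_assoc, ← exp_add]
      refine mul_le_mul (Finset.single_le_sum (fun j _ => hC0 j) (Finset.mem_univ j))
        (exp_le_exp.2 (by linarith)) (exp_pos _).le (Finset.sum_nonneg fun j _ => hC0 j)
    calc σ⁻¹ * (|k' j (z - σ⁻¹ • y)| * |f (σ • z)|)
        ≤ σ⁻¹ * (((∑ j, C j) * exp (3 / 4) * exp (-(1 / 8) * sqSum (z - σ⁻¹ • x))) * B) := by
          gcongr
          · exact (abs_nonneg _).trans h3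
          · exact hB _
      _ = _ := by ring
  · exact (((integrable_exp_neg_mul_sqSum (by norm_num : (0 : ℝ) < 1 / 8)).comp_sub_right
      (σ⁻¹ • x)).const_mul _).const_mul _
  · have h1 : HasFDerivAt (fun y : Fin 3 → ℝ => z - σ⁻¹ • y)
        (-(σ⁻¹ • ContinuousLinearMap.id ℝ (Fin 3 → ℝ))) y :=
      ((hasFDerivAt_id y).const_smul σ⁻¹).const_sub z
    have h2 := ((hd (z - σ⁻¹ • y)).comp y h1).mul_const (f (σ • z))
    refine h2.congr_fderiv ?_
    ext e
    simp only [ContinuousLinearMap.comp_apply, smul_apply, neg_apply, dualOf_apply, smul_eq_mul,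
      ContinuousLinearMap.id_apply, Finset.mul_sum, Pi.neg_apply, Pi.smul_apply]
    exact Finset.sum_congr rfl fun i _ => by ring

lemma integral_hermiteTwo_mul (j i : Fin 3) : ∫ z, hermiteTwo j i z * gaussKer z = 0 := by
  have h := hasFDerivAt_heatAvg (f := fun _ => 1) (B := 1) (gaussianBounded_apply_mul j)
    (gaussianBounded_hermiteTwo_mul j) (hasFDerivAt_apply_mul_gaussKer j) continuous_const
    (by simp) one_pos 0
  have h0 : HasFDerivAt (heatAvg (fun z => z j * gaussKer z) (fun _ => 1) 1)
      (0 : (Fin 3 → ℝ) →L[ℝ] ℝ) 0 := by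
    unfold heatAvg
    exact hasFDerivAt_const _ _
  have h1 := congrArg (fun l : (Fin 3 → ℝ) →L[ℝ] ℝ => l (Pi.single i 1)) (h.unique h0)
  simpa [dualOf_single, heatAvg] using h1

end heatAvg

section heatEquation

variable {k f : (Fin 3 → ℝ) → ℝ} {B : ℝ}

lemma heatAvg_eq_scaled (k f : (Fin 3 → ℝ) → ℝ) {σ : ℝ} (hσ : 0 < σ) (x : Fin 3 → ℝ) :
    heatAvg k f σ x = (σ ^ 3)⁻¹ * ∫ y, k (σ⁻¹ • y) * f (x + y) := by
  have h := Measure.integral_comp_smul (volume : Measure (Fin 3 → ℝ))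
    (fun y => k (σ⁻¹ • y) * f (x + y)) σ
  simp only [smul_smul, inv_mul_cancel₀ hσ.ne', one_smul, Module.finrank_fin_fun, smul_eq_mul] at h
  rw [abs_of_pos (by positivity)] at h
  exact h

lemma gaussianBounded_sqSum_mul : GaussianBounded (fun z => sqSum z * gaussKer z) :=
  gaussianBounded_mul continuous_sqSum (C := 1) fun z => by
    rw [abs_of_nonneg (sqSum_nonneg z)]; linarith

lemma sum_heatAvg_hermiteTwo (hf : Continuous f) (hB : ∀ x, |f x| ≤ B) (σ : ℝ) (x : Fin 3 → ℝ) :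
    ∑ j, heatAvg (fun z => hermiteTwo j j z * gaussKer z) f σ x =
      heatAvg (fun z => sqSum z * gaussKer z) f σ x - 3 * heatAvg gaussKer f σ x := by
  unfold heatAvg
  rw [← integral_finsetSum _ fun j _ =>
    integrable_kernel_mul (gaussianBounded_hermiteTwo_mul j j).integrable hf hB σ x,
    ← integral_const_mul, ← integral_sub
    (integrable_kernel_mul gaussianBounded_sqSum_mul.integrable hf hB σ x)
    ((integrable_kernel_mul gaussianBounded_gaussKer.integrable hf hB σ x).const_mul 3)]
  refine integral_congr_ae (ae_of_all _ fun z => ?_)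
  simp only [hermiteTwo, sqSum, Fin.sum_univ_three, if_true]
  ring

lemma integrable_sqSum_mul_exp {b : ℝ} (hb : 0 < b) :
    Integrable (fun z : Fin 3 → ℝ => sqSum z * exp (-b * sqSum z)) := by
  refine ((integrable_exp_neg_mul_sqSum (half_pos hb)).const_mul (b / 2)⁻¹).mono'
    (by fun_prop) (ae_of_all _ fun z => ?_)
  have h0 := sqSum_nonneg z
  rw [Real.norm_eq_abs, abs_of_nonneg (by positivity)]
  have h := add_one_le_exp (b / 2 * sqSum z)
  have h1 : sqSum z ≤ (b / 2)⁻¹ * exp (b / 2 * sqSum z) := by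
    rw [← div_eq_inv_mul, le_div_iff₀ (half_pos hb)]; nlinarith
  calc sqSum z * exp (-b * sqSum z)
      ≤ ((b / 2)⁻¹ * exp (b / 2 * sqSum z)) * exp (-b * sqSum z) := by gcongr
    _ = _ := by rw [mul_assoc, ← exp_add]; ring_nf

lemma hasDerivAt_inv_sqrt_cube {τ : ℝ} (hτ : 0 < τ) :
    HasDerivAt (fun τ : ℝ => (√(2 * τ) ^ 3)⁻¹) (-(3 * (2 * τ)⁻¹ * (√(2 * τ) ^ 3)⁻¹)) τ := by
  have hs : 0 < √(2 * τ) := Real.sqrt_pos.2 (by linarith)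
  have h2 : √(2 * τ) ^ 2 = 2 * τ := Real.sq_sqrt (by linarith)
  have h := ((((hasDerivAt_id τ).const_mul 2).sqrt (by simpa using hτ.ne')).pow 3).inv
    (by simpa using hs.ne')
  refine h.congr_deriv ?_
  simp only [id, Pi.pow_apply]
  rw [← h2]
  field_simp
  norm_num
  ring

/-- Gaussian averages solve the heat equation. -/
lemma hasDerivAt_heatAvg (hf : Continuous f) (hB : ∀ x, |f x| ≤ B) (x : Fin 3 → ℝ) {τ : ℝ}
    (hτ : 0 < τ) :
    HasDerivAt (fun τ => heatAvg gaussKer f √(2 * τ) x)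
      ((2 * τ)⁻¹ * ∑ j, heatAvg (fun z => hermiteTwo j j z * gaussKer z) f √(2 * τ) x) τ := by
  set c : ℝ := (∫ y : Fin 3 → ℝ, exp (-(1 / 2) * sqSum y))⁻¹ with hc
  have hc0 : 0 ≤ c := inv_nonneg.2 gaussKer_const_pos.le
  have hB0 : 0 ≤ B := (abs_nonneg _).trans (hB 0)
  have hs : ∀ τ : ℝ, 0 < τ → 0 < √(2 * τ) := fun τ h => Real.sqrt_pos.2 (by linarith)
  have hinv : ∀ τ : ℝ, 0 < τ → ∀ y, sqSum ((√(2 * τ))⁻¹ • y) = (2 * τ)⁻¹ * sqSum y :=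
    fun τ h y => by rw [sqSum_smul, inv_pow, Real.sq_sqrt (by linarith)]
  have hg : ∀ τ : ℝ, 0 < τ → ∀ y, gaussKer ((√(2 * τ))⁻¹ • y) = c * exp (-(4 * τ)⁻¹ * sqSum y) :=
    fun τ h y => by
      rw [gaussKer, hinv τ h]
      congr 2
      field_simp
      ring
  have key := hasDerivAt_integral_of_dominated_loc_of_deriv_le (μ := volume) (𝕜 := ℝ)
    (F := fun τ y => c * exp (-(4 * τ)⁻¹ * sqSum y) * f (x + y))
    (F' := fun τ y => c * exp (-(4 * τ)⁻¹ * sqSum y) * ((4 * τ ^ 2)⁻¹ * sqSum y) * f (x + y))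
    (x₀ := τ) (s := Ioo (τ / 2) (2 * τ))
    (bound := fun y => c * (τ ^ 2)⁻¹ * B * (sqSum y * exp (-(8 * τ)⁻¹ * sqSum y)))
    (Ioo_mem_nhds (by linarith) (by linarith)) (Eventually.of_forall fun s => by fun_prop)
    (((integrable_exp_neg_mul_sqSum (by positivity)).const_mul c).mul_bdd (c := B) (by fun_prop)
      (ae_of_all _ fun z => hB _))
    (by fun_prop) (ae_of_all _ fun y s hs => ?_)
    ((integrable_sqSum_mul_exp (by positivity)).const_mul _) (ae_of_all _ fun y s hs => ?_)
  · have h1 := (hasDerivAt_inv_sqrt_cube hτ).mul key.2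
    have hev : (fun τ => heatAvg gaussKer f √(2 * τ) x) =ᶠ[𝓝 τ]
        fun τ => (√(2 * τ) ^ 3)⁻¹ * ∫ y, c * exp (-(4 * τ)⁻¹ * sqSum y) * f (x + y) := by
      filter_upwards [Ioi_mem_nhds hτ] with s hs'
      rw [heatAvg_eq_scaled _ _ (hs s hs')]
      congr 1
      exact integral_congr_ae (ae_of_all _ fun y => by simp only [hg s hs' y])
    refine (h1.congr_of_eventuallyEq hev).congr_deriv ?_
    rw [sum_heatAvg_hermiteTwo hf hB, heatAvg_eq_scaled _ _ (hs τ hτ),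
      heatAvg_eq_scaled gaussKer _ (hs τ hτ)]
    simp only [hg τ hτ, hinv τ hτ]
    have h2 : ∫ y, c * exp (-(4 * τ)⁻¹ * sqSum y) * ((4 * τ ^ 2)⁻¹ * sqSum y) * f (x + y) =
        (2 * τ)⁻¹ * ∫ y, (2 * τ)⁻¹ * sqSum y * (c * exp (-(4 * τ)⁻¹ * sqSum y)) * f (x + y) := by
      rw [← integral_const_mul]
      refine integral_congr_ae (ae_of_all _ fun y => ?_)
      field_simp
      ring
    rw [h2]
    ring
  · have hs1 : 0 < s := by linarith [hs.1]
    have h0 := sqSum_nonneg y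
    rw [Real.norm_eq_abs, abs_mul, abs_of_nonneg (a := _ * _) (by positivity)]
    have e1 : exp (-(4 * s)⁻¹ * sqSum y) ≤ exp (-(8 * τ)⁻¹ * sqSum y) := by
      refine exp_le_exp.2 (mul_le_mul_of_nonneg_right (neg_le_neg ?_) h0)
      exact inv_anti₀ (by linarith) (by linarith [hs.2])
    have e2 : (4 * s ^ 2)⁻¹ ≤ (τ ^ 2)⁻¹ :=
      inv_anti₀ (by positivity) (by nlinarith [hs.1])
    calc c * exp (-(4 * s)⁻¹ * sqSum y) * ((4 * s ^ 2)⁻¹ * sqSum y) * |f (x + y)|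
        ≤ c * exp (-(8 * τ)⁻¹ * sqSum y) * ((τ ^ 2)⁻¹ * sqSum y) * B := by gcongr; exact hB _
      _ = _ := by ring
  · have hs1 : s ≠ 0 := by linarith [hs.1]
    have h1 : HasDerivAt (fun s : ℝ => -(4 * s)⁻¹ * sqSum y) ((4 * s ^ 2)⁻¹ * sqSum y) s := by
      have := (((hasDerivAt_id s).const_mul 4).inv (by simpa using hs1)).neg.mul_const (sqSum y)
      refine this.congr_deriv ?_
      simp only [id]
      field_simp
    refine ((h1.exp.const_mul c).mul_const (f (x + y))).congr_deriv ?_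
    ring

end heatEquation

/-- The Duhamel integral of the forcing `g`, with time weight `ω` and spatial kernel `k`. -/
noncomputable def duhamel (ω : ℝ → ℝ) (k : (Fin 3 → ℝ) → ℝ) (g : ℝ → (Fin 3 → ℝ) → ℝ) (t : ℝ)
    (x : Fin 3 → ℝ) : ℝ :=
  ∫ τ in Ioi (0 : ℝ), ω τ * heatAvg k (g (t - τ)) √(2 * τ) x

/-- Bounded forcing terms which vanish for nonpositive times and are continuous for positive
times. -/
structure IsForcing (g : ℝ → (Fin 3 → ℝ) → ℝ) (B : ℝ) : Prop where
  zero : ∀ s ≤ 0, ∀ x, g s x = 0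
  contOn : ContinuousOn (fun p : ℝ × (Fin 3 → ℝ) => g p.1 p.2) (Ioi 0 ×ˢ univ)
  bound : ∀ s x, |g s x| ≤ B

/-- A locally uniform integrable bound for the integrand of the Duhamel integral. -/
def DuhamelBound (ω : ℝ → ℝ) (k : (Fin 3 → ℝ) → ℝ) (g : ℝ → (Fin 3 → ℝ) → ℝ) : Prop :=
  ∀ T : ℝ, ∃ bd : ℝ → ℝ, IntegrableOn bd (Ioi 0) ∧
    ∀ s < T, ∀ x, ∀ τ > 0, |ω τ * heatAvg k (g s) √(2 * τ) x| ≤ bd τ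

namespace IsForcing

variable {g : ℝ → (Fin 3 → ℝ) → ℝ} {B : ℝ}

lemma continuousAt (hg : IsForcing g B) {s : ℝ} (hs : s ≠ 0) (x : Fin 3 → ℝ) :
    ContinuousAt (fun p : ℝ × (Fin 3 → ℝ) => g p.1 p.2) (s, x) := by
  rcases lt_or_gt_of_ne hs with h | h
  · refine continuousAt_const.congr (f := fun _ => (0 : ℝ)) ?_
    have : ∀ᶠ p : ℝ × (Fin 3 → ℝ) in 𝓝 (s, x), p.1 < 0 :=
      continuous_fst.continuousAt.eventually (Iio_mem_nhds h)
    filter_upwards [this] with p hp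
    exact (hg.zero _ hp.le _).symm
  · exact hg.contOn.continuousAt ((isOpen_Ioi.prod isOpen_univ).mem_nhds ⟨h, mem_univ _⟩)

lemma continuous (hg : IsForcing g B) (s : ℝ) : Continuous (g s) := by
  rcases eq_or_ne s 0 with h | h
  · have : g s = fun _ => 0 := funext fun x => hg.zero s h.le x
    rw [this]; exact continuous_const
  · exact continuous_iff_continuousAt.2 fun x =>
      (hg.continuousAt h x).comp (f := fun y => (s, y)) (by fun_prop)

lemma measurable (hg : IsForcing g B) : Measurable (fun p : ℝ × (Fin 3 → ℝ) => g p.1 p.2) := by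
  have h := hg.contOn.measurable_piecewise (g := fun _ => (0 : ℝ)) continuousOn_const
    (isOpen_Ioi.prod isOpen_univ).measurableSet
  convert h using 1
  funext p
  by_cases hp : 0 < p.1
  · have hp' : p ∈ Ioi (0 : ℝ) ×ˢ (univ : Set (Fin 3 → ℝ)) := ⟨hp, mem_univ _⟩
    rw [piecewise_eq_of_mem _ _ _ hp']
  · rw [piecewise_eq_of_notMem _ _ _ fun h => hp h.1, hg.zero _ (not_lt.1 hp)]

variable {ω : ℝ → ℝ} {k : (Fin 3 → ℝ) → ℝ}

lemma measurable_heatAvg (hg : IsForcing g B) (hk : Continuous k) (x : Fin 3 → ℝ) :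
    Measurable (fun p : ℝ × ℝ => heatAvg k (g p.2) √(2 * p.1) x) := by
  have h : StronglyMeasurable (fun q : (ℝ × ℝ) × (Fin 3 → ℝ) =>
      k q.2 * g q.1.2 (x + √(2 * q.1.1) • q.2)) := by
    refine Measurable.stronglyMeasurable ?_
    refine (hk.measurable.comp measurable_snd).mul
      (hg.measurable.comp (f := fun q : (ℝ × ℝ) × (Fin 3 → ℝ) =>
        (q.1.2, x + √(2 * q.1.1) • q.2)) (Continuous.measurable (by fun_prop)))
  exact h.integral_prod_right.measurable

lemma measurable_integrand (hg : IsForcing g B) (hω : Measurable ω) (hk : Continuous k) (t : ℝ)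
    (x : Fin 3 → ℝ) : Measurable (fun τ => ω τ * heatAvg k (g (t - τ)) √(2 * τ) x) :=
  hω.mul ((hg.measurable_heatAvg hk x).comp (f := fun τ => (τ, t - τ)) (by fun_prop))

lemma integrableOn_integrand (hg : IsForcing g B) (hω : Measurable ω) (hk : Continuous k)
    (hb : DuhamelBound ω k g) (t : ℝ) (x : Fin 3 → ℝ) :
    IntegrableOn (fun τ => ω τ * heatAvg k (g (t - τ)) √(2 * τ) x) (Ioi 0) := by
  obtain ⟨bd, hbd, h⟩ := hb t
  refine Integrable.mono' hbd (hg.measurable_integrand hω hk t x).aestronglyMeasurable ?_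
  filter_upwards [ae_restrict_mem measurableSet_Ioi] with τ hτ
  exact h (t - τ) (by linarith [mem_Ioi.1 hτ]) x τ hτ

lemma continuousAt_heatAvg (hg : IsForcing g B) (hk : GaussianBounded k) {t τ : ℝ} (h : t ≠ τ)
    (x : Fin 3 → ℝ) :
    ContinuousAt (fun p : ℝ × (Fin 3 → ℝ) => heatAvg k (g (p.1 - τ)) √(2 * τ) p.2) (t, x) := by
  refine continuousAt_of_dominated (bound := fun z => |k z| * B)
    (Eventually.of_forall fun p => (integrable_kernel_mul hk.integrable (hg.continuous _)
      (hg.bound _) _ p.2).aestronglyMeasurable)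
    (Eventually.of_forall fun p => ae_of_all _ fun z => ?_) (hk.integrable.abs.mul_const B)
    (ae_of_all _ fun z => ?_)
  · rw [Real.norm_eq_abs, abs_mul]
    exact mul_le_mul_of_nonneg_left (hg.bound _ _) (abs_nonneg _)
  · refine continuousAt_const.mul ?_
    have h1 := hg.continuousAt (sub_ne_zero.2 h) (x + √(2 * τ) • z)
    have h2 : ContinuousAt (fun p : ℝ × (Fin 3 → ℝ) => (p.1 - τ, p.2 + √(2 * τ) • z)) (t, x) := by
      fun_prop
    exact ContinuousAt.comp (g := fun p : ℝ × (Fin 3 → ℝ) => g p.1 p.2)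
      (f := fun p : ℝ × (Fin 3 → ℝ) => (p.1 - τ, p.2 + √(2 * τ) • z)) (x := (t, x)) h1 h2

lemma continuous_duhamel (hg : IsForcing g B) (hω : Measurable ω) (hk : GaussianBounded k)
    (hb : DuhamelBound ω k g) :
    Continuous (fun p : ℝ × (Fin 3 → ℝ) => duhamel ω k g p.1 p.2) := by
  rw [continuous_iff_continuousAt]
  rintro ⟨t, x⟩
  obtain ⟨bd, hbd, h⟩ := hb (t + 1)
  refine continuousAt_of_dominated (bound := bd)
    (Eventually.of_forall fun p => (hg.measurable_integrand hω hk.cont p.1 p.2).aestronglyMeasurable)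
    ?_ hbd ?_
  · have : ∀ᶠ p : ℝ × (Fin 3 → ℝ) in 𝓝 (t, x), p.1 < t + 1 :=
      continuous_fst.continuousAt.eventually (Iio_mem_nhds (by simp))
    filter_upwards [this] with p hp
    filter_upwards [ae_restrict_mem measurableSet_Ioi] with τ hτ
    exact h (p.1 - τ) (by linarith [mem_Ioi.1 hτ]) p.2 τ hτ
  · have : ∀ᵐ τ : ℝ ∂volume.restrict (Ioi 0), τ ≠ t :=
      ae_restrict_of_ae (by simp [ae_iff, measure_singleton])
    filter_upwards [this] with τ hτ
    exact continuousAt_const.mul (hg.continuousAt_heatAvg hk hτ.symm x)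

lemma hasFDerivAt_duhamel (hg : IsForcing g B) (hω : Measurable ω)
    {k' : Fin 3 → (Fin 3 → ℝ) → ℝ} (hk : GaussianBounded k)
    (hk' : ∀ j, GaussianBounded (k' j))
    (hd : ∀ z, HasFDerivAt k (dualOf fun j => -k' j z) z) (hb : DuhamelBound ω k g)
    (hb' : ∀ j, DuhamelBound (fun τ => ω τ * (√(2 * τ))⁻¹) (k' j) g) (t : ℝ) (x : Fin 3 → ℝ) :
    HasFDerivAt (duhamel ω k g t)
      (dualOf fun j => duhamel (fun τ => ω τ * (√(2 * τ))⁻¹) (k' j) g t x) x := by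
  have hω' : Measurable (fun τ : ℝ => ω τ * (√(2 * τ))⁻¹) := by fun_prop
  choose bd hbd h using fun j => hb' j t
  have key := hasFDerivAt_integral_of_dominated_of_fderiv_le (μ := volume.restrict (Ioi (0 : ℝ)))
    (𝕜 := ℝ) (F := fun x τ => ω τ * heatAvg k (g (t - τ)) √(2 * τ) x)
    (F' := fun x τ => dualOf fun j =>
      (ω τ * (√(2 * τ))⁻¹) * heatAvg (k' j) (g (t - τ)) √(2 * τ) x)
    (x₀ := x) (s := univ) (bound := fun τ => ‖dualOf‖ * ∑ j, bd j τ) univ_mem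
    (Eventually.of_forall fun y => (hg.measurable_integrand hω hk.cont t y).aestronglyMeasurable)
    (hg.integrableOn_integrand hω hk.cont hb t x)
    (dualOf.continuous.measurable.comp (measurable_pi_iff.2 fun j =>
      hg.measurable_integrand hω' (hk' j).cont t x)).aestronglyMeasurable ?_
    ((integrable_finsetSum _ fun j _ => hbd j).const_mul _) ?_
  · refine key.congr_fderiv ?_
    have hint := fun j => hg.integrableOn_integrand hω' (hk' j).cont (hb' j) t x
    rw [ContinuousLinearMap.integral_comp_comm dualOf (Integrable.of_eval hint)]
    congr 1
    funext j
    rw [eval_integral (fun i => hint i)]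
    rfl
  · filter_upwards [ae_restrict_mem measurableSet_Ioi] with τ hτ y _
    have h0 : ∀ j, |ω τ * (√(2 * τ))⁻¹ * heatAvg (k' j) (g (t - τ)) √(2 * τ) y| ≤ bd j τ :=
      fun j => h j (t - τ) (by linarith [mem_Ioi.1 hτ]) y τ hτ
    have h1 : ∀ j, 0 ≤ bd j τ := fun j => (abs_nonneg _).trans (h0 j)
    refine (dualOf.le_opNorm _).trans (mul_le_mul_of_nonneg_left ?_ (norm_nonneg _))
    refine (pi_norm_le_iff_of_nonneg (Finset.sum_nonneg fun j _ => h1 j)).2 fun j => ?_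
    exact (h0 j).trans
      (Finset.single_le_sum (f := fun j => bd j τ) (fun j _ => h1 j) (Finset.mem_univ j))
  · filter_upwards [ae_restrict_mem measurableSet_Ioi] with τ hτ y _
    have h2 := (hasFDerivAt_heatAvg hk hk' hd (hg.continuous (t - τ)) (hg.bound _)
      (Real.sqrt_pos.2 (by linarith [mem_Ioi.1 hτ]) : 0 < √(2 * τ)) y).const_mul (ω τ)
    refine h2.congr_fderiv ?_
    rw [← map_smul]
    congr 1
    funext j
    simp [mul_assoc]

end IsForcing

/-- The time weights occurring in the Duhamel formula with damping `a` and `n` derivatives. -/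
noncomputable def weight (a : ℝ) (n : ℕ) (τ : ℝ) : ℝ := exp (-a * τ) * ((√(2 * τ))⁻¹) ^ n

lemma measurable_weight (a : ℝ) (n : ℕ) : Measurable (weight a n) := by
  unfold weight; fun_prop

lemma weight_nonneg (a : ℝ) (n : ℕ) (τ : ℝ) : 0 ≤ weight a n τ := by
  unfold weight; positivity

lemma weight_succ (a : ℝ) (n : ℕ) :
    weight a (n + 1) = fun τ => weight a n τ * (√(2 * τ))⁻¹ := by
  funext τ; simp [weight, pow_succ, mul_assoc]

lemma weight_eq_rpow (a : ℝ) (n : ℕ) {τ : ℝ} (hτ : 0 < τ) :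
    weight a n τ = ((√2)⁻¹) ^ n * (τ ^ ((1 - n / 2 : ℝ) - 1) * exp (-(a * τ))) := by
  have : ((√τ)⁻¹) ^ n = τ ^ ((1 - n / 2 : ℝ) - 1) := by
    rw [Real.sqrt_eq_rpow, ← Real.rpow_neg hτ.le, ← Real.rpow_natCast, ← Real.rpow_mul hτ.le]
    ring_nf
  rw [weight, Real.sqrt_mul (by norm_num), mul_inv, mul_pow, this, neg_mul]
  ring

lemma integrableOn_weight {a : ℝ} (ha : 0 < a) {n : ℕ} (hn : n ≤ 1) :
    IntegrableOn (weight a n) (Ioi 0) := by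
  have hn' : (0 : ℝ) < 1 - n / 2 := by
    have : (n : ℝ) ≤ 1 := by exact_mod_cast hn
    linarith
  have h : IntegrableOn (fun τ : ℝ => τ ^ ((1 - n / 2 : ℝ) - 1) * exp (-a * τ)) (Ioi 0) := by
    have := integrableOn_rpow_mul_exp_neg_mul_rpow (s := (1 - n / 2 : ℝ) - 1) (p := 1) (b := a)
      (by linarith) one_pos ha
    simpa using this
  refine (h.const_mul (((√2)⁻¹) ^ n)).congr ?_
  filter_upwards [ae_restrict_mem measurableSet_Ioi] with τ hτ
  rw [weight_eq_rpow a n hτ, neg_mul]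

lemma integral_weight {a : ℝ} (ha : 0 < a) {n : ℕ} (hn : n ≤ 1) :
    ∫ τ in Ioi 0, weight a n τ =
      ((√2)⁻¹) ^ n * ((1 / a) ^ (1 - n / 2 : ℝ) * Real.Gamma (1 - n / 2)) := by
  have hn' : (0 : ℝ) < 1 - n / 2 := by
    have : (n : ℝ) ≤ 1 := by exact_mod_cast hn
    linarith
  rw [← Real.integral_rpow_mul_exp_neg_mul_Ioi hn' ha, ← integral_const_mul]
  exact setIntegral_congr_fun measurableSet_Ioi fun τ hτ => weight_eq_rpow a n hτ

lemma tendsto_integral_weight {n : ℕ} (hn : n ≤ 1) :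
    Tendsto (fun a : ℝ => ∫ τ in Ioi 0, weight a n τ) atTop (𝓝 0) := by
  have hn' : (0 : ℝ) < 1 - n / 2 := by
    have : (n : ℝ) ≤ 1 := by exact_mod_cast hn
    linarith
  have h : Tendsto (fun a : ℝ => ((√2)⁻¹) ^ n * ((1 / a) ^ (1 - n / 2 : ℝ) *
      Real.Gamma (1 - n / 2))) atTop (𝓝 (((√2)⁻¹) ^ n * (0 ^ (1 - n / 2 : ℝ) *
      Real.Gamma (1 - n / 2)))) := by
    have h0 : Tendsto (fun a : ℝ => 1 / a) atTop (𝓝 0) := by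
      simpa only [one_div] using tendsto_inv_atTop_zero (𝕜 := ℝ)
    exact ((h0.rpow_const (Or.inr hn'.le)).mul_const _).const_mul _
  rw [Real.zero_rpow hn'.ne', zero_mul, mul_zero] at h
  refine h.congr' ?_
  filter_upwards [eventually_gt_atTop 0] with a ha
  exact (integral_weight ha hn).symm

section duhamelBounds

variable {g : ℝ → (Fin 3 → ℝ) → ℝ} {B : ℝ} {k : (Fin 3 → ℝ) → ℝ}

lemma duhamelBound_of_integrable (hB : ∀ s x, |g s x| ≤ B) (hk : GaussianBounded k) {a : ℝ}
    (ha : 0 < a) {n : ℕ} (hn : n ≤ 1) : DuhamelBound (weight a n) k g := by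
  refine fun T => ⟨fun τ => weight a n τ * ((∫ z, |k z|) * B),
    (integrableOn_weight ha hn).mul_const _, fun s _ x τ _ => ?_⟩
  rw [abs_mul, abs_of_nonneg (weight_nonneg a n τ)]
  exact mul_le_mul_of_nonneg_left (abs_heatAvg_le hk.integrable (hB s) _ x) (weight_nonneg a n τ)

lemma abs_duhamel_le (hB : ∀ s x, |g s x| ≤ B) (hk : GaussianBounded k) {a : ℝ}
    (ha : 0 < a) {n : ℕ} (hn : n ≤ 1) (t : ℝ) (x : Fin 3 → ℝ) :
    |duhamel (weight a n) k g t x| ≤ (∫ τ in Ioi 0, weight a n τ) * (∫ z, |k z|) * B := by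
  rw [mul_assoc, ← integral_mul_const, ← Real.norm_eq_abs]
  refine norm_integral_le_of_norm_le ((integrableOn_weight ha hn).mul_const _)
    (ae_of_all _ fun τ => ?_)
  rw [Real.norm_eq_abs, abs_mul, abs_of_nonneg (weight_nonneg a n τ)]
  exact mul_le_mul_of_nonneg_left (abs_heatAvg_le hk.integrable (hB _) _ x) (weight_nonneg a n τ)

/-- Spatial Lipschitz bounds, locally uniform in time. -/
def LipschitzUpTo (g : ℝ → (Fin 3 → ℝ) → ℝ) : Prop :=
  ∀ T : ℝ, ∃ Λ, 0 ≤ Λ ∧ ∀ s < T, ∀ x h, |g s (x + h) - g s x| ≤ Λ * ‖h‖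

lemma duhamelBound_hermiteTwo (hg : IsForcing g B) (hL : LipschitzUpTo g) {a : ℝ} (ha : 0 < a)
    (j i : Fin 3) : DuhamelBound (weight a 2) (fun z => hermiteTwo j i z * gaussKer z) g := by
  intro T
  obtain ⟨Λ, hΛ0, hΛ⟩ := hL T
  refine ⟨fun τ => weight a 1 τ * ((∫ z, ‖z‖ * |hermiteTwo j i z * gaussKer z|) * Λ),
    (integrableOn_weight ha le_rfl).mul_const _, fun s hs x τ hτ => ?_⟩
  have hσ : 0 < √(2 * τ) := Real.sqrt_pos.2 (by linarith)
  rw [abs_mul, abs_of_nonneg (weight_nonneg a 2 τ)]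
  have h := abs_heatAvg_le_of_integral_eq_zero (gaussianBounded_hermiteTwo_mul j i)
    (integral_hermiteTwo_mul j i) (hg.continuous s) (hg.bound s) (hΛ s hs) hσ.le x
  refine (mul_le_mul_of_nonneg_left h (weight_nonneg a 2 τ)).trans_eq ?_
  rw [weight_succ]
  simp only []
  field_simp

end duhamelBounds

/-- Fubini's theorem on the triangle `0 < s < r < T`, in the form of an integrated Leibniz rule for
convolution integrals. -/
lemma integral_convolution_eq {P Q : ℝ → ℝ → ℝ} {γ bd : ℝ → ℝ} {T : ℝ} (hT : 0 < T)
    (hQm : Measurable (fun p : ℝ × ℝ => Q p.1 p.2)) (hP0 : ∀ τ, ∀ s ≤ 0, P τ s = 0)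
    (hQ0 : ∀ τ, ∀ s ≤ 0, Q τ s = 0)
    (hPQ : ∀ τ > 0, ∀ s < T, P τ s = γ s + ∫ σ in (0 : ℝ)..τ, Q σ s)
    (hbd : IntegrableOn bd (Ioi 0)) (hQbd : ∀ s < T, ∀ τ > 0, |Q τ s| ≤ bd τ)
    (hγ : IntervalIntegrable γ volume 0 T)
    (hy : IntervalIntegrable (fun r => ∫ τ in Ioi (0 : ℝ), Q τ (r - τ)) volume 0 T) :
    ∫ τ in Ioi (0 : ℝ), P τ (T - τ) =
      ∫ r in (0 : ℝ)..T, (γ r + ∫ τ in Ioi (0 : ℝ), Q τ (r - τ)) := by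
  set S : Set (ℝ × ℝ) := {p | 0 < p.2 ∧ p.2 < p.1 ∧ p.1 < T} with hS
  have hSm : MeasurableSet S := by
    refine (measurableSet_lt measurable_const measurable_snd).inter
      ((measurableSet_lt measurable_snd measurable_fst).inter
        (measurableSet_lt measurable_fst measurable_const))
  set R : ℝ → ℝ → ℝ := fun r s => S.indicator (fun p => Q (p.1 - p.2) p.2) (r, s) with hR
  have hRint : Integrable (Function.uncurry R) (volume.prod volume) := by
    have h1 : Integrable ((Ioo 0 T).indicator fun _ : ℝ => (1 : ℝ)) :=
      (integrable_indicator_iff measurableSet_Ioo).2 (integrableOn_const (by simp))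
    have h2 : Integrable ((Ioi 0).indicator bd) := (integrable_indicator_iff measurableSet_Ioi).2 hbd
    refine (h1.convolution_integrand (ContinuousLinearMap.mul ℝ ℝ) h2).mono' ?_
      (ae_of_all _ fun p => ?_)
    · refine Measurable.aestronglyMeasurable ?_
      exact (hQm.comp (f := fun p : ℝ × ℝ => (p.1 - p.2, p.2)) (by fun_prop)).indicator hSm
    · obtain ⟨r, s⟩ := p
      simp only [Function.uncurry, hR, ContinuousLinearMap.mul_apply']
      by_cases h : (r, s) ∈ S
      · obtain ⟨h3, h4, h5⟩ := h
        simp only at h3 h4 h5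
        rw [indicator_of_mem (show (r, s) ∈ S from ⟨h3, h4, h5⟩),
          indicator_of_mem (show s ∈ Ioo 0 T from ⟨h3, h4.trans h5⟩),
          indicator_of_mem (show r - s ∈ Ioi 0 from sub_pos.2 h4), one_mul]
        exact hQbd s (h4.trans h5) _ (sub_pos.2 h4)
      · rw [indicator_of_notMem h, norm_zero]
        refine mul_nonneg (indicator_nonneg (fun _ _ => zero_le_one) _)
          (indicator_nonneg (fun τ hτ => ?_) _)
        exact (abs_nonneg _).trans (hQbd 0 hT τ hτ)
  have hRr : ∀ r, ∫ s, R r s = (Ioo 0 T).indicator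
      (fun r => ∫ τ in Ioi (0 : ℝ), Q τ (r - τ)) r := fun r => by
    by_cases hr : r ∈ Ioo 0 T
    · rw [indicator_of_mem hr, ← integral_sub_left_eq_self _ _ r,
        ← integral_indicator measurableSet_Ioi]
      congr 1
      funext τ
      simp only [hR]
      by_cases hτ : 0 < τ
      · rw [indicator_of_mem (mem_Ioi.2 hτ)]
        by_cases h : 0 < r - τ
        · rw [indicator_of_mem (show (r, r - τ) ∈ S from ⟨h, by simpa using hτ, hr.2⟩)]
          simp
        · rw [indicator_of_notMem (fun h' : (r, r - τ) ∈ S => h h'.1), hQ0 _ _ (not_lt.1 h)]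
      · rw [indicator_of_notMem (show τ ∉ Ioi 0 from hτ),
          indicator_of_notMem (fun h' : (r, r - τ) ∈ S => hτ (by simpa using h'.2.1))]
    · rw [indicator_of_notMem hr]
      have : R r = fun _ => 0 := funext fun s =>
        indicator_of_notMem (fun h : (r, s) ∈ S => hr ⟨h.1.trans h.2.1, h.2.2⟩) _
      rw [this, integral_zero]
  have hRs : ∀ s, ∫ r, R r s = (Ioo 0 T).indicator (fun s => P (T - s) s - γ s) s := fun s => by
    by_cases hs : s ∈ Ioo 0 T
    · rw [indicator_of_mem hs, hPQ _ (sub_pos.2 hs.2) s hs.2, add_sub_cancel_left,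
        intervalIntegral.integral_of_le (sub_pos.2 hs.2).le, integral_Ioc_eq_integral_Ioo,
        ← integral_indicator measurableSet_Ioo,
        ← integral_sub_right_eq_self (fun τ => (Ioo 0 (T - s)).indicator (fun σ => Q σ s) τ) s]
      congr 1
      funext r
      simp only [hR]
      by_cases h : (r, s) ∈ S
      · rw [indicator_of_mem h, indicator_of_mem]
        exact ⟨sub_pos.2 h.2.1, sub_lt_sub_right h.2.2 s⟩
      · rw [indicator_of_notMem h, indicator_of_notMem]
        exact fun h' => h ⟨hs.1, sub_pos.1 h'.1, by linarith [h'.2]⟩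
    · rw [indicator_of_notMem hs]
      have : (fun r => R r s) = fun _ => 0 := funext fun r =>
        indicator_of_notMem (fun h : (r, s) ∈ S => hs ⟨h.1, h.2.1.trans h.2.2⟩) _
      rw [this, integral_zero]
  have hswap := integral_integral_swap hRint
  simp only [hRr, hRs] at hswap
  have hPint : IntegrableOn (fun s => P (T - s) s - γ s) (Ioo 0 T) := by
    have := hRint.integral_prod_right
    simp only [Function.uncurry, hRs] at this
    exact (integrable_indicator_iff measurableSet_Ioo).1 this
  have hγ' : IntegrableOn γ (Ioo 0 T) :=
    ((intervalIntegrable_iff_integrableOn_Ioo_of_le hT.le).1 hγ)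
  rw [intervalIntegral.integral_add hγ hy, intervalIntegral.integral_of_le hT.le,
    intervalIntegral.integral_of_le hT.le, integral_Ioc_eq_integral_Ioo,
    integral_Ioc_eq_integral_Ioo, ← integral_indicator (f := fun r => ∫ τ in Ioi (0 : ℝ), Q τ (r - τ))
    measurableSet_Ioo, hswap, integral_indicator measurableSet_Ioo, ← integral_add hγ' hPint,
    ← integral_indicator measurableSet_Ioi, ← integral_indicator measurableSet_Ioo,
    ← integral_sub_left_eq_self _ _ T]
  congr 1
  funext s
  by_cases hs : s ∈ Ioo 0 T
  · rw [indicator_of_mem hs, indicator_of_mem (show T - s ∈ Ioi 0 from sub_pos.2 hs.2)]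
    simp
  · rw [indicator_of_notMem hs]
    by_cases h : T - s ∈ Ioi (0 : ℝ)
    · rw [indicator_of_mem h, sub_sub_cancel]
      exact hP0 _ _ (not_lt.1 fun h' => hs ⟨h', sub_pos.1 h⟩)
    · rw [indicator_of_notMem h]

namespace IsForcing

variable {g : ℝ → (Fin 3 → ℝ) → ℝ} {B : ℝ}

lemma hasDerivAt_damped_heatAvg {f : (Fin 3 → ℝ) → ℝ} (hf : Continuous f) (hB : ∀ x, |f x| ≤ B)
    (a : ℝ) (x : Fin 3 → ℝ) {τ : ℝ} (hτ : 0 < τ) :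
    HasDerivAt (fun τ => weight a 0 τ * heatAvg gaussKer f √(2 * τ) x)
      (∑ j, weight a 2 τ * heatAvg (fun z => hermiteTwo j j z * gaussKer z) f √(2 * τ) x
        - a * (weight a 0 τ * heatAvg gaussKer f √(2 * τ) x)) τ := by
  have h1 : HasDerivAt (weight a 0) (-a * weight a 0 τ) τ := by
    have := ((hasDerivAt_id τ).const_mul (-a)).exp
    have h : weight a 0 = fun τ => exp (-a * id τ) := by funext τ; simp [weight]
    rw [h]
    refine this.congr_deriv (by simp; ring)
  refine (h1.mul (hasDerivAt_heatAvg hf hB x hτ)).congr_deriv ?_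
  have h2 : weight a 2 τ = weight a 0 τ * (2 * τ)⁻¹ := by
    simp only [weight, pow_zero, mul_one, inv_pow]
    rw [Real.sq_sqrt (by linarith)]
  rw [← Finset.mul_sum, h2]
  ring

lemma hasDerivAt_duhamel (hg : IsForcing g B) (hL : LipschitzUpTo g) {a : ℝ} (ha : 0 < a)
    (x : Fin 3 → ℝ) {t : ℝ} (ht : 0 < t) :
    HasDerivAt (fun t => duhamel (weight a 0) gaussKer g t x)
      (g t x + (∑ j, duhamel (weight a 2) (fun z => hermiteTwo j j z * gaussKer z) g t x
        - a * duhamel (weight a 0) gaussKer g t x)) t := by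
  have hb0 : DuhamelBound (weight a 0) gaussKer g :=
    duhamelBound_of_integrable hg.bound gaussianBounded_gaussKer ha zero_le_one
  have hb2 := fun j => duhamelBound_hermiteTwo hg hL ha j j
  have hc0 := hg.continuous_duhamel (measurable_weight a 0) gaussianBounded_gaussKer hb0
  have hc2 := fun j => hg.continuous_duhamel (measurable_weight a 2)
    (gaussianBounded_hermiteTwo_mul j j) (hb2 j)
  set P : ℝ → ℝ → ℝ := fun τ s => weight a 0 τ * heatAvg gaussKer (g s) √(2 * τ) x with hP
  set Q : ℝ → ℝ → ℝ := fun τ s =>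
    ∑ j, weight a 2 τ * heatAvg (fun z => hermiteTwo j j z * gaussKer z) (g s) √(2 * τ) x
      - a * (weight a 0 τ * heatAvg gaussKer (g s) √(2 * τ) x) with hQ
  have hQint : ∀ r, ∫ τ in Ioi (0 : ℝ), Q τ (r - τ) =
      ∑ j, duhamel (weight a 2) (fun z => hermiteTwo j j z * gaussKer z) g r x
        - a * duhamel (weight a 0) gaussKer g r x := fun r => by
    have hi0 := hg.integrableOn_integrand (measurable_weight a 0)
      gaussianBounded_gaussKer.cont hb0 r x
    have hi2 := fun j => hg.integrableOn_integrand (measurable_weight a 2)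
      (gaussianBounded_hermiteTwo_mul j j).cont (hb2 j) r x
    simp only [hQ]
    rw [integral_sub (integrable_finsetSum _ fun j _ => hi2 j) (hi0.const_mul a),
      integral_finsetSum _ fun j _ => hi2 j, integral_const_mul]
    rfl
  have hyc : Continuous fun r => ∫ τ in Ioi (0 : ℝ), Q τ (r - τ) := by
    simp only [hQint]
    refine (continuous_finsetSum _ fun j _ => ?_).sub (continuous_const.mul ?_)
    · exact (hc2 j).comp (f := fun r => (r, x)) (by fun_prop)
    · exact hc0.comp (f := fun r => (r, x)) (by fun_prop)
  have hQm : Measurable (fun p : ℝ × ℝ => Q p.1 p.2) := by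
    have h0 := hg.measurable_heatAvg gaussianBounded_gaussKer.cont x
    have h2 := fun j => hg.measurable_heatAvg (gaussianBounded_hermiteTwo_mul j j).cont x
    have hw : ∀ n, Measurable (fun p : ℝ × ℝ => weight a n p.1) := fun n =>
      (measurable_weight a n).comp measurable_fst
    exact (Finset.measurable_fun_sum _ fun j _ => (hw 2).mul (h2 j)).sub
      (((hw 0).mul h0).const_mul a)
  have hz : ∀ (k : (Fin 3 → ℝ) → ℝ) (τ : ℝ), ∀ s ≤ 0, heatAvg k (g s) √(2 * τ) x = 0 :=
    fun k τ s hs => by simp [heatAvg, hg.zero s hs]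
  have hγm : Measurable fun s => g s x :=
    hg.measurable.comp (f := fun s => (s, x)) (by fun_prop)
  have hγ : ∀ T, IntervalIntegrable (fun s => g s x) volume 0 T := fun T =>
    (intervalIntegrable_const (c := B)).mono_fun hγm.aestronglyMeasurable
      (ae_of_all _ fun s => by
        exact (hg.bound s x).trans (le_abs_self _))
  have key : ∀ T > 0, duhamel (weight a 0) gaussKer g T x =
      ∫ r in (0 : ℝ)..T, (g r x + ∫ τ in Ioi (0 : ℝ), Q τ (r - τ)) := fun T hT => by
    obtain ⟨bd0, hbd0, h0⟩ := hb0 T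
    choose bd2 hbd2 h2 using fun j => hb2 j T
    have hbd : IntegrableOn (fun τ => ∑ j, bd2 j τ + a * bd0 τ) (Ioi 0) :=
      (integrable_finsetSum _ fun j _ => hbd2 j).add (hbd0.const_mul a)
    have hQbd : ∀ s < T, ∀ τ > 0, |Q τ s| ≤ ∑ j, bd2 j τ + a * bd0 τ := fun s hs τ hτ => by
      refine (abs_sub _ _).trans (add_le_add ?_ ?_)
      · exact (Finset.abs_sum_le_sum_abs _ _).trans
          (Finset.sum_le_sum fun j _ => h2 j s hs x τ hτ)
      · rw [abs_mul, abs_of_pos ha]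
        exact mul_le_mul_of_nonneg_left (h0 s hs x τ hτ) ha.le
    refine integral_convolution_eq (P := P) hT hQm (fun τ s hs => ?_) (fun τ s hs => ?_)
      (fun τ hτ s hs => ?_) hbd hQbd (hγ T) (hyc.intervalIntegrable _ _)
    · simp only [hP, hz _ _ s hs, mul_zero]
    · simp only [hQ, hz _ _ s hs, mul_zero, Finset.sum_const_zero, sub_zero]
    · have hcont : Continuous fun τ => P τ s := by
        have hw : Continuous (weight a 0) := by
          unfold weight; simp only [pow_zero, mul_one]; fun_prop
        exact hw.mul ((continuous_heatAvg gaussianBounded_gaussKer.integrable (hg.continuous s)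
          (hg.bound s)).comp (f := fun τ : ℝ => (√(2 * τ), x)) (by fun_prop))
      have hint : IntervalIntegrable (fun σ => Q σ s) volume 0 τ := by
        rw [intervalIntegrable_iff_integrableOn_Ioc_of_le hτ.le]
        refine (hbd.mono_set Ioc_subset_Ioi_self).mono'
          (hQm.comp (f := fun σ => (σ, s)) (by fun_prop)).aestronglyMeasurable ?_
        filter_upwards [ae_restrict_mem measurableSet_Ioc] with σ hσ
        exact hQbd s hs σ hσ.1
      have := intervalIntegral.integral_eq_sub_of_hasDerivAt_of_le hτ.le hcont.continuousOn
        (fun σ hσ => hasDerivAt_damped_heatAvg (hg.continuous s) (hg.bound s) a x hσ.1) hint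
      have hP0 : P 0 s = g s x := by
        simp [hP, weight, heatAvg, integral_mul_const, integral_gaussKer]
      rw [this, hP0]
      ring
  have hcont : ContinuousAt (fun r => g r x + ∫ τ in Ioi (0 : ℝ), Q τ (r - τ)) t :=
    ((hg.continuousAt ht.ne' x).comp (f := fun r => (r, x)) (by fun_prop)).add hyc.continuousAt
  have hder := intervalIntegral.integral_hasDerivAt_right
    ((hγ t).add (hyc.intervalIntegrable 0 t))
    ((hγm.add hyc.measurable).stronglyMeasurable.stronglyMeasurableAtFilter) hcont
  rw [← hQint t]
  refine hder.congr_of_eventuallyEq ?_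
  filter_upwards [Ioi_mem_nhds ht] with T hT
  exact key T hT

end IsForcing

section linearity

variable {g g' : ℝ → (Fin 3 → ℝ) → ℝ} {B B' : ℝ} {k : (Fin 3 → ℝ) → ℝ}

lemma duhamel_add_right (ω : ℝ → ℝ) (k : (Fin 3 → ℝ) → ℝ) (g : ℝ → (Fin 3 → ℝ) → ℝ) (t : ℝ)
    (x h : Fin 3 → ℝ) : duhamel ω k g t (x + h) = duhamel ω k (fun s x => g s (x + h)) t x := by
  simp only [duhamel, heatAvg, add_right_comm]

lemma IsForcing.add_right (hg : IsForcing g B) (h : Fin 3 → ℝ) :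
    IsForcing (fun s x => g s (x + h)) B where
  zero s hs x := hg.zero s hs _
  contOn := hg.contOn.comp (f := fun p : ℝ × (Fin 3 → ℝ) => (p.1, p.2 + h)) (by fun_prop)
    fun p hp => ⟨hp.1, mem_univ _⟩
  bound s x := hg.bound s _

lemma abs_duhamel_sub_le (hg : IsForcing g B) (hg' : IsForcing g' B') (hk : GaussianBounded k)
    {a : ℝ} (ha : 0 < a) {n : ℕ} (hn : n ≤ 1) {D : ℝ} (hD : ∀ s x, |g s x - g' s x| ≤ D) (t : ℝ)
    (x : Fin 3 → ℝ) :
    |duhamel (weight a n) k g t x - duhamel (weight a n) k g' t x| ≤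
      (∫ τ in Ioi 0, weight a n τ) * (∫ z, |k z|) * D := by
  have h : duhamel (weight a n) k g t x - duhamel (weight a n) k g' t x =
      duhamel (weight a n) k (fun s x => g s x - g' s x) t x := by
    rw [duhamel, duhamel, ← integral_sub
      (hg.integrableOn_integrand (measurable_weight a n) hk.cont
        (duhamelBound_of_integrable hg.bound hk ha hn) t x)
      (hg'.integrableOn_integrand (measurable_weight a n) hk.cont
        (duhamelBound_of_integrable hg'.bound hk ha hn) t x)]
    refine integral_congr_ae (ae_of_all _ fun τ => ?_)
    simp only [heatAvg, mul_sub]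
    rw [← mul_sub, integral_sub (integrable_kernel_mul hk.integrable (hg.continuous _)
      (hg.bound _) _ x) (integrable_kernel_mul hk.integrable (hg'.continuous _) (hg'.bound _) _ x)]
  rw [h]
  exact abs_duhamel_le hD hk ha hn t x

lemma exp_mul_duhamel (a ν : ℝ) (n : ℕ) (k : (Fin 3 → ℝ) → ℝ) (g : ℝ → (Fin 3 → ℝ) → ℝ) (t : ℝ)
    (x : Fin 3 → ℝ) :
    exp (ν * t) * duhamel (weight (a + ν) n) k g t x =
      duhamel (weight a n) k (fun s x => exp (ν * s) * g s x) t x := by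
  rw [duhamel, duhamel, ← integral_const_mul]
  refine integral_congr_ae (ae_of_all _ fun τ => ?_)
  have h1 : ∀ z, k z * (exp (ν * (t - τ)) * g (t - τ) (x + √(2 * τ) • z)) =
      exp (ν * (t - τ)) * (k z * g (t - τ) (x + √(2 * τ) • z)) := fun z => by ring
  have h2 : exp (-(a + ν) * τ) * exp (ν * t) = exp (-a * τ) * exp (ν * (t - τ)) := by
    rw [← exp_add, ← exp_add]; ring_nf
  simp only [heatAvg, h1, integral_const_mul, weight]
  linear_combination (((√(2 * τ))⁻¹) ^ n *
    ∫ z, k z * g (t - τ) (x + √(2 * τ) • z)) * h2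

end linearity

/-- Values and spatial gradients of the three velocity components. -/
abbrev Jet : Type := Fin 3 → Option (Fin 3) → ℝ

/-- The kernels of the Duhamel formula for a solution and its spatial gradient. -/
noncomputable def jetKer : Option (Fin 3) → (Fin 3 → ℝ) → ℝ
  | none => gaussKer
  | some j => fun z => z j * gaussKer z

/-- The order of differentiation attached to an entry of a jet. -/
def jetOrder : Option (Fin 3) → ℕ
  | none => 0
  | some _ => 1

lemma gaussianBounded_jetKer (m : Option (Fin 3)) : GaussianBounded (jetKer m) := by
  cases m with
  | none => exact gaussianBounded_gaussKer
  | some j => exact gaussianBounded_apply_mul j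

lemma jetOrder_le_one (m : Option (Fin 3)) : jetOrder m ≤ 1 := by
  cases m <;> simp [jetOrder]

/-- The forcing term obtained from the nonlinearity `N` after the exponential rescaling by `ν`. -/
noncomputable def scaledForcing (N : (Fin 3 → ℝ) → Jet → (Fin 3 → ℝ)) (ν : ℝ)
    (W : ℝ × (Fin 3 → ℝ) → Jet) (i : Fin 3) (s : ℝ) (x : Fin 3 → ℝ) : ℝ :=
  if 0 < s then exp (-(ν * s)) * N x (exp (ν * s) • W (s, x)) i else 0

section fixedPoint

variable {N : (Fin 3 → ℝ) → Jet → (Fin 3 → ℝ)} {B L ν : ℝ}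

lemma isForcing_scaledForcing (hN : Continuous (fun p : (Fin 3 → ℝ) × Jet => N p.1 p.2))
    (hB : ∀ x y, ‖N x y‖ ≤ B) (hν : 0 ≤ ν) {W : ℝ × (Fin 3 → ℝ) → Jet} (hW : Continuous W)
    (i : Fin 3) : IsForcing (scaledForcing N ν W i) B where
  zero s hs x := if_neg (not_lt.2 hs)
  contOn := by
    have h : Continuous (fun p : ℝ × (Fin 3 → ℝ) =>
        exp (-(ν * p.1)) * N p.2 (exp (ν * p.1) • W (p.1, p.2)) i) := by
      refine Continuous.mul (by fun_prop) ?_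
      exact (continuous_apply i).comp (hN.comp
        (f := fun p : ℝ × (Fin 3 → ℝ) => (p.2, exp (ν * p.1) • W (p.1, p.2))) (by fun_prop))
    exact h.continuousOn.congr fun p hp => if_pos hp.1
  bound s x := by
    have hB0 : 0 ≤ B := (norm_nonneg _).trans (hB 0 0)
    unfold scaledForcing
    split_ifs with hs
    · rw [abs_mul, abs_of_pos (exp_pos _)]
      have h1 : exp (-(ν * s)) ≤ 1 := exp_le_one_iff.2 (by nlinarith)
      have h2 : |N x (exp (ν * s) • W (s, x)) i| ≤ B := (norm_le_pi_norm _ i).trans (hB _ _)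
      nlinarith [exp_pos (-(ν * s)), abs_nonneg (N x (exp (ν * s) • W (s, x)) i)]
    · simpa using hB0

lemma abs_scaledForcing_sub_le {c : ℝ} (hν : 0 ≤ ν) (hc : 0 ≤ c) (hL0 : 0 ≤ L)
    (hL : ∀ x y y', ‖N x y - N x y'‖ ≤ L * ‖y - y'‖) {h : Fin 3 → ℝ}
    (hh : ∀ x y, ‖N (x + h) y - N x y‖ ≤ c) (W W' : ℝ × (Fin 3 → ℝ) → Jet) {S : ℝ}
    (hS : ∀ t x, ‖W (t, x + h) - W' (t, x)‖ ≤ S) (i : Fin 3) (s : ℝ) (x : Fin 3 → ℝ) :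
    |scaledForcing N ν W i s (x + h) - scaledForcing N ν W' i s x| ≤ c + L * S := by
  have hS0 : 0 ≤ S := (norm_nonneg _).trans (hS 0 0)
  unfold scaledForcing
  split_ifs with hs
  · rw [← mul_sub, abs_mul, abs_of_pos (exp_pos _)]
    set y := exp (ν * s) • W (s, x + h)
    set y' := exp (ν * s) • W' (s, x)
    have h1 : exp (-(ν * s)) ≤ 1 := exp_le_one_iff.2 (by nlinarith)
    have h2 : ‖y - y'‖ ≤ exp (ν * s) * S := by
      rw [← smul_sub, norm_smul, Real.norm_eq_abs, abs_of_pos (exp_pos _)]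
      exact mul_le_mul_of_nonneg_left (hS _ _) (exp_pos _).le
    have h3 : |N (x + h) y i - N x y' i| ≤ c + L * (exp (ν * s) * S) := by
      have : ‖N (x + h) y - N x y'‖ ≤ c + L * (exp (ν * s) * S) :=
        (norm_sub_le_norm_sub_add_norm_sub _ (N x y) _).trans (add_le_add (hh x y)
          ((hL x y y').trans (mul_le_mul_of_nonneg_left h2 hL0)))
      exact (norm_le_pi_norm (N (x + h) y - N x y') i).trans this
    have h4 : exp (-(ν * s)) * exp (ν * s) = 1 := by rw [← exp_add]; simp
    calc exp (-(ν * s)) * |N (x + h) y i - N x y' i|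
        ≤ exp (-(ν * s)) * (c + L * (exp (ν * s) * S)) :=
          mul_le_mul_of_nonneg_left h3 (exp_pos _).le
      _ = exp (-(ν * s)) * c + L * S := by linear_combination (L * S) * h4
      _ ≤ c + L * S := by nlinarith
  · simp only [sub_zero, abs_zero]; positivity

/-- The Picard map of the rescaled Duhamel formulation. -/
noncomputable def picard (N : (Fin 3 → ℝ) → Jet → (Fin 3 → ℝ)) (a ν : ℝ)
    (W : ℝ × (Fin 3 → ℝ) → Jet) (p : ℝ × (Fin 3 → ℝ)) : Jet := fun i m =>
  duhamel (weight (a + ν) (jetOrder m)) (jetKer m) (scaledForcing N ν W i) p.1 p.2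

variable {a θ : ℝ}

lemma norm_picard_sub_le (hN : Continuous (fun p : (Fin 3 → ℝ) × Jet => N p.1 p.2))
    (hB : ∀ x y, ‖N x y‖ ≤ B) (hL0 : 0 ≤ L) (hL : ∀ x y y', ‖N x y - N x y'‖ ≤ L * ‖y - y'‖)
    (ha : 0 < a) (hν : 0 ≤ ν)
    (hθ : ∀ m, (∫ τ in Ioi 0, weight (a + ν) (jetOrder m) τ) * (∫ z, |jetKer m z|) ≤ θ)
    {h : Fin 3 → ℝ} {c : ℝ} (hc : 0 ≤ c) (hh : ∀ x y, ‖N (x + h) y - N x y‖ ≤ c)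
    {W W' : ℝ × (Fin 3 → ℝ) → Jet} (hW : Continuous W) (hW' : Continuous W') {S : ℝ}
    (hS : ∀ t x, ‖W (t, x + h) - W' (t, x)‖ ≤ S) (t : ℝ) (x : Fin 3 → ℝ) :
    ‖picard N a ν W (t, x + h) - picard N a ν W' (t, x)‖ ≤ θ * (c + L * S) := by
  have hS0 : 0 ≤ S := (norm_nonneg _).trans (hS 0 0)
  have hD : 0 ≤ c + L * S := by positivity
  have hθ0 : 0 ≤ θ := le_trans (mul_nonneg (integral_nonneg fun τ => weight_nonneg _ _ τ)
    (integral_nonneg fun z => abs_nonneg _)) (hθ none)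
  refine (pi_norm_le_iff_of_nonneg (by positivity)).2 fun i =>
    (pi_norm_le_iff_of_nonneg (by positivity)).2 fun m => ?_
  rw [Pi.sub_apply, Pi.sub_apply, Real.norm_eq_abs]
  simp only [picard]
  rw [duhamel_add_right]
  refine (abs_duhamel_sub_le ((isForcing_scaledForcing hN hB hν hW i).add_right h)
    (isForcing_scaledForcing hN hB hν hW' i) (gaussianBounded_jetKer m) (by linarith)
    (jetOrder_le_one m) (abs_scaledForcing_sub_le hν hc hL0 hL hh W W' hS i) t x).trans ?_
  exact mul_le_mul_of_nonneg_right (hθ m) hD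

lemma continuous_picard (hN : Continuous (fun p : (Fin 3 → ℝ) × Jet => N p.1 p.2))
    (hB : ∀ x y, ‖N x y‖ ≤ B) (ha : 0 < a) (hν : 0 ≤ ν) {W : ℝ × (Fin 3 → ℝ) → Jet}
    (hW : Continuous W) : Continuous (picard N a ν W) := by
  refine continuous_pi fun i => continuous_pi fun m => ?_
  have hg := isForcing_scaledForcing hN hB hν hW i
  exact hg.continuous_duhamel (measurable_weight _ _) (gaussianBounded_jetKer m)
    (duhamelBound_of_integrable hg.bound (gaussianBounded_jetKer m) (by linarith)
      (jetOrder_le_one m))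

lemma norm_picard_le (hN : Continuous (fun p : (Fin 3 → ℝ) × Jet => N p.1 p.2))
    (hB : ∀ x y, ‖N x y‖ ≤ B) (ha : 0 < a) (hν : 0 ≤ ν)
    (hθ : ∀ m, (∫ τ in Ioi 0, weight (a + ν) (jetOrder m) τ) * (∫ z, |jetKer m z|) ≤ θ)
    {W : ℝ × (Fin 3 → ℝ) → Jet} (hW : Continuous W) (p : ℝ × (Fin 3 → ℝ)) :
    ‖picard N a ν W p‖ ≤ θ * B := by
  have hB0 : 0 ≤ B := (norm_nonneg _).trans (hB 0 0)
  have hθ0 : 0 ≤ θ := le_trans (mul_nonneg (integral_nonneg fun τ => weight_nonneg _ _ τ)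
    (integral_nonneg fun z => abs_nonneg _)) (hθ none)
  refine (pi_norm_le_iff_of_nonneg (by positivity)).2 fun i =>
    (pi_norm_le_iff_of_nonneg (by positivity)).2 fun m => ?_
  exact (abs_duhamel_le (isForcing_scaledForcing hN hB hν hW i).bound (gaussianBounded_jetKer m)
    (by linarith) (jetOrder_le_one m) p.1 p.2).trans (mul_le_mul_of_nonneg_right (hθ m) hB0)

/-- The smallness of the Duhamel operators for large damping. -/
lemma exists_forall_duhamel_norm_le {θ : ℝ} (hθ : 0 < θ) :
    ∃ b, ∀ a ≥ b, ∀ m,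
      (∫ τ in Ioi 0, weight a (jetOrder m) τ) * (∫ z, |jetKer m z|) ≤ θ := by
  have h : ∀ᶠ a in atTop, ∀ m,
      (∫ τ in Ioi 0, weight a (jetOrder m) τ) * (∫ z, |jetKer m z|) ≤ θ := by
    refine eventually_all.2 fun m => ?_
    have := (tendsto_integral_weight (jetOrder_le_one m)).mul_const (∫ z, |jetKer m z|)
    rw [zero_mul] at this
    exact this.eventually_le_const hθ
  exact eventually_atTop.1 h

theorem exists_duhamel_fixedPoint (hN : Continuous (fun p : (Fin 3 → ℝ) × Jet => N p.1 p.2))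
    (hB : ∀ x y, ‖N x y‖ ≤ B) (hL0 : 0 ≤ L) (hL : ∀ x y y', ‖N x y - N x y'‖ ≤ L * ‖y - y'‖)
    (ha : 0 < a) :
    ∃ ν, 0 ≤ ν ∧ ∃ W : ℝ → (Fin 3 → ℝ) → Jet,
      Continuous (fun p : ℝ × (Fin 3 → ℝ) => W p.1 p.2) ∧
      (∀ t x i m, W t x i m = duhamel (weight a (jetOrder m)) (jetKer m)
        (fun s x => if 0 < s then N x (W s x) i else 0) t x) ∧
      ∀ h c, 0 ≤ c → (∀ x y, ‖N (x + h) y - N x y‖ ≤ c) →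
        ∀ t x, ‖W t (x + h) - W t x‖ ≤ c * exp (ν * t) := by
  obtain ⟨b, hb⟩ := exists_forall_duhamel_norm_le (θ := 1 / (2 * (L + 1))) (by positivity)
  set ν := max b 0 with hνdef
  have hν : 0 ≤ ν := le_max_right _ _
  set θ := 1 / (2 * (L + 1)) with hθdef
  have hθ : ∀ m, (∫ τ in Ioi 0, weight (a + ν) (jetOrder m) τ) * (∫ z, |jetKer m z|) ≤ θ :=
    hb _ (by linarith [le_max_left b 0])
  have hθ0 : 0 < θ := by positivity
  have hθ2 : θ * (L + 1) = 1 / 2 := by rw [hθdef]; field_simp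
  have hθ1 : θ ≤ 1 / 2 := by nlinarith
  let Φ : BoundedContinuousFunction (ℝ × (Fin 3 → ℝ)) Jet →
      BoundedContinuousFunction (ℝ × (Fin 3 → ℝ)) Jet := fun W =>
    BoundedContinuousFunction.ofNormedAddCommGroup (picard N a ν W)
      (continuous_picard hN hB ha hν W.continuous) (θ * B)
      (norm_picard_le hN hB ha hν hθ W.continuous)
  have hΦ : ContractingWith (1 / 2) Φ := by
    refine ⟨by rw [← NNReal.coe_lt_coe]; norm_num, LipschitzWith.of_dist_le_mul fun W W' => ?_⟩
    refine (BoundedContinuousFunction.dist_le (by positivity)).2 fun p => ?_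
    have h := norm_picard_sub_le hN hB hL0 hL ha hν hθ (h := 0) le_rfl (by simp) W.continuous
      W'.continuous (S := dist W W') (fun t x => by
        rw [add_zero, ← dist_eq_norm]
        exact BoundedContinuousFunction.dist_coe_le_dist _) p.1 p.2
    rw [add_zero, ← dist_eq_norm] at h
    refine h.trans ?_
    have : ((1 / 2 : NNReal) : ℝ) = 1 / 2 := by norm_num
    rw [this]
    nlinarith [dist_nonneg (x := W) (y := W')]
  set V := ContractingWith.fixedPoint Φ hΦ with hV
  have hfix : ∀ p, V p = picard N a ν V p := fun p => by
    conv_lhs => rw [hV, ← ContractingWith.fixedPoint_isFixedPt hΦ]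
    rfl
  refine ⟨ν, hν, fun t x => exp (ν * t) • V (t, x), ?_, fun t x i m => ?_,
    fun h c hc hh t x => ?_⟩
  · have := V.continuous
    fun_prop
  · simp only [Pi.smul_apply, smul_eq_mul]
    rw [hfix, picard, exp_mul_duhamel]
    congr 1
    funext s x
    unfold scaledForcing
    split_ifs with hs
    · rw [← mul_assoc, ← exp_add, add_neg_cancel, exp_zero, one_mul]
    · rw [mul_zero]
  · let Vh : BoundedContinuousFunction (ℝ × (Fin 3 → ℝ)) Jet :=
      V.compContinuous ⟨fun p => (p.1, p.2 + h), by fun_prop⟩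
    have hle : ∀ t x, ‖V (t, x + h) - V (t, x)‖ ≤ dist Vh V := fun t x => by
      rw [← dist_eq_norm]
      exact BoundedContinuousFunction.dist_coe_le_dist (f := Vh) (g := V) (t, x)
    have h1 : dist Vh V ≤ θ * (c + L * dist Vh V) := by
      refine (BoundedContinuousFunction.dist_le (by positivity)).2 fun p => ?_
      have h := norm_picard_sub_le hN hB hL0 hL ha hν hθ hc hh V.continuous V.continuous hle
        p.1 p.2
      rw [← hfix, ← hfix] at h
      rw [dist_eq_norm]
      exact h
    have h2 : dist Vh V ≤ c := by
      nlinarith [dist_nonneg (x := Vh) (y := V)]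
    rw [← smul_sub, norm_smul, Real.norm_eq_abs, abs_of_pos (exp_pos _), mul_comm]
    exact mul_le_mul_of_nonneg_right ((hle t x).trans h2) (exp_pos _).le

end fixedPoint

/-- Periodic functions are determined by their values on the cube `[0, 2π]³`. -/
lemma exists_mem_cube (x : Fin 3 → ℝ) :
    ∃ y ∈ (univ.pi fun _ : Fin 3 => Icc (0 : ℝ) (2 * Real.pi)),
      ∀ f : (Fin 3 → ℝ) → ℝ, (∀ x j, f (x + Pi.single j (2 * Real.pi)) = f x) → f x = f y := by
  have hπ : (0 : ℝ) < 2 * Real.pi := by positivity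
  refine ⟨fun i => toIcoMod hπ 0 (x i), fun i _ => ?_, fun f hf => ?_⟩
  · have := toIcoMod_mem_Ico hπ 0 (x i)
    rw [zero_add] at this
    exact Ico_subset_Icc_self this
  · have hn : ∀ (n : ℕ) x j, f (x + Pi.single j (n * (2 * Real.pi))) = f x := fun n => by
      induction n with
      | zero => simp
      | succ n ih =>
        intro x j
        have : (Pi.single j (((n + 1 : ℕ) : ℝ) * (2 * Real.pi)) : Fin 3 → ℝ) =
            Pi.single j (n * (2 * Real.pi)) + Pi.single j (2 * Real.pi) := by
          rw [← Pi.single_add]; push_cast; ring_nf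
        rw [this, ← add_assoc, hf, ih]
    have hz : ∀ (n : ℤ) x j, f (x + Pi.single j (n * (2 * Real.pi))) = f x := fun n x j => by
      obtain ⟨k, rfl | rfl⟩ := n.eq_nat_or_neg
      · exact_mod_cast hn k x j
      · rw [← hn k (x + _) j, add_assoc, ← Pi.single_add]
        simp
    have hx : x = (fun i => toIcoMod hπ 0 (x i)) +
        Pi.single 0 (toIcoDiv hπ 0 (x 0) * (2 * Real.pi)) +
        Pi.single 1 (toIcoDiv hπ 0 (x 1) * (2 * Real.pi)) +
        Pi.single 2 (toIcoDiv hπ 0 (x 2) * (2 * Real.pi)) := by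
      funext i
      have h := toIcoMod_add_toIcoDiv_zsmul hπ 0 (x i)
      rw [zsmul_eq_mul] at h
      fin_cases i <;> simp
    conv_lhs => rw [hx, hz, hz, hz]

lemma isCompact_cube : IsCompact (univ.pi fun _ : Fin 3 => Icc (0 : ℝ) (2 * Real.pi)) :=
  isCompact_univ_pi fun _ => isCompact_Icc

lemma exists_abs_le_of_periodic {f : (Fin 3 → ℝ) → ℝ} (hf : Continuous f)
    (hper : ∀ x j, f (x + Pi.single j (2 * Real.pi)) = f x) : ∃ C, ∀ x, |f x| ≤ C := by
  obtain ⟨C, hC⟩ := isCompact_cube.exists_bound_of_continuousOn hf.continuousOn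
  refine ⟨C, fun x => ?_⟩
  obtain ⟨y, hy, h⟩ := exists_mem_cube x
  rw [h f hper]
  exact hC y hy

lemma pd_periodic {f : (Fin 3 → ℝ) → ℝ}
    (hper : ∀ x j, f (x + Pi.single j (2 * Real.pi)) = f x) (i : Fin 3) (x : Fin 3 → ℝ)
    (j : Fin 3) : pd i f (x + Pi.single j (2 * Real.pi)) = pd i f x := by
  unfold pd
  rw [← fderiv_comp_add_right]
  simp only [hper]

lemma hasDerivAt_line {f : (Fin 3 → ℝ) → ℝ} (hf : Differentiable ℝ f) (x : Fin 3 → ℝ) (j : Fin 3)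
    (s : ℝ) : HasDerivAt (fun s => f (x + s • Pi.single j 1))
      (pd j f (x + s • Pi.single j 1)) s := by
  have h1 : HasDerivAt (fun s : ℝ => x + s • (Pi.single j 1 : Fin 3 → ℝ)) (Pi.single j 1) s := by
    simpa using ((hasDerivAt_id s).smul_const (Pi.single j (1 : ℝ) : Fin 3 → ℝ)).const_add x
  exact (hf _).hasFDerivAt.comp_hasDerivAt s h1

lemma contDiff_pd {f : (Fin 3 → ℝ) → ℝ} {n m : WithTop ℕ∞} (hf : ContDiff ℝ n f) (h : m + 1 ≤ n)
    (j : Fin 3) : ContDiff ℝ m (pd j f) :=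
  (hf.fderiv_right h).clm_apply contDiff_const

lemma pd_eq_zero_of_isMax {f : (Fin 3 → ℝ) → ℝ} {x : Fin 3 → ℝ} (hx : ∀ y, f y ≤ f x)
    (j : Fin 3) : pd j f x = 0 := by
  have : IsLocalMax f x := Eventually.of_forall hx
  simp [pd, this.fderiv_eq_zero]

lemma lap_nonpos_of_isMax {f : (Fin 3 → ℝ) → ℝ} (hf : ContDiff ℝ 2 f) {x : Fin 3 → ℝ}
    (hx : ∀ y, f y ≤ f x) : lap f x ≤ 0 := by
  refine Finset.sum_nonpos fun j _ => ?_
  by_contra! hpos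
  have hf1 : Differentiable ℝ f := hf.differentiable (by norm_num)
  have hf2 : Differentiable ℝ (pd j f) :=
    (contDiff_pd (m := 1) hf (by norm_num) j).differentiable (by norm_num)
  set φ : ℝ → ℝ := fun s => f (x + s • Pi.single j 1) with hφ
  have hd : deriv φ = fun s => pd j f (x + s • Pi.single j 1) :=
    funext fun s => (hasDerivAt_line hf1 x j s).deriv
  have hdd : deriv (deriv φ) 0 = pd j (pd j f) x := by
    rw [hd, (hasDerivAt_line hf2 x j 0).deriv]; simp
  have hd0 : deriv φ 0 = 0 := by
    rw [hd]; simpa using pd_eq_zero_of_isMax hx j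
  have hc : ContinuousAt φ 0 := (hasDerivAt_line hf1 x j 0).continuousAt
  have hmin : IsLocalMin φ 0 := isLocalMin_of_deriv_deriv_pos (by rw [hdd]; exact hpos) hd0 hc
  have hconst : φ =ᶠ[𝓝 0] fun _ => φ 0 := by
    filter_upwards [hmin] with s hs
    refine le_antisymm ?_ hs
    simpa [hφ] using hx (x + s • Pi.single j 1)
  have h1 : deriv φ =ᶠ[𝓝 0] fun _ => 0 := by
    simpa using hconst.deriv
  have h2 := h1.deriv_eq
  rw [hdd, deriv_const] at h2
  exact hpos.ne' h2

/-- The parabolic maximum principle for periodic functions. -/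
theorem le_of_forall_deriv_le_lap {v : ℝ → (Fin 3 → ℝ) → ℝ} {M : ℝ}
    (hc : ContinuousOn (fun p : ℝ × (Fin 3 → ℝ) => v p.1 p.2) (Ici 0 ×ˢ univ))
    (hper : ∀ t x j, v t (x + Pi.single j (2 * Real.pi)) = v t x) (h0 : ∀ x, v 0 x ≤ M)
    (ht : ∀ t > 0, ∀ x, DifferentiableAt ℝ (fun t => v t x) t)
    (hx : ∀ t > 0, ContDiff ℝ 2 (v t))
    (h : ∀ t > 0, ∀ x, M < v t x → (∀ j, pd j (v t) x = 0) →
      deriv (fun t => v t x) t ≤ lap (v t) x) :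
    ∀ t ≥ 0, ∀ x, v t x ≤ M := by
  by_contra! hcon
  obtain ⟨T, hT, z, hz⟩ := hcon
  obtain ⟨ε, hε, hεT⟩ : ∃ ε > 0, ε * T < v T z - M := by
    refine ⟨(v T z - M) / (2 * (T + 1)), by have := sub_pos.2 hz; positivity, ?_⟩
    have h1 := sub_pos.2 hz
    rw [div_mul_eq_mul_div, div_lt_iff₀ (by positivity)]
    nlinarith
  set K : Set (ℝ × (Fin 3 → ℝ)) :=
    Icc 0 T ×ˢ (univ.pi fun _ : Fin 3 => Icc (0 : ℝ) (2 * Real.pi)) with hK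
  have hKc : IsCompact K := isCompact_Icc.prod isCompact_cube
  have hcK : ContinuousOn (fun p : ℝ × (Fin 3 → ℝ) => v p.1 p.2 - ε * p.1) K :=
    (hc.mono (prod_mono Icc_subset_Ici_self (subset_univ _))).sub (by fun_prop)
  obtain ⟨y, hy, hzy⟩ := exists_mem_cube z
  have hne : K.Nonempty := ⟨(T, y), ⟨hT, le_rfl⟩, hy⟩
  obtain ⟨⟨t₀, x₀⟩, hmem, hmax⟩ := hKc.exists_isMaxOn hne hcK
  have hmax' : ∀ t ∈ Icc 0 T, ∀ x, v t x - ε * t ≤ v t₀ x₀ - ε * t₀ := fun t ht x => by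
    obtain ⟨x', hx', hxx'⟩ := exists_mem_cube x
    rw [hxx' (v t) (hper t)]
    exact hmax (show (t, x') ∈ K from ⟨ht, hx'⟩)
  have hgt : M < v t₀ x₀ - ε * t₀ :=
    lt_of_lt_of_le (by linarith) (hmax' T ⟨hT, le_rfl⟩ z)
  have ht₀ : 0 < t₀ := by
    refine lt_of_le_of_ne hmem.1.1 fun h' => ?_
    rw [← h'] at hgt
    linarith [h0 x₀]
  have hspace : ∀ x, v t₀ x ≤ v t₀ x₀ := fun x => by linarith [hmax' t₀ hmem.1 x]
  have hlap := lap_nonpos_of_isMax (hx t₀ ht₀) hspace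
  have hle := (h t₀ ht₀ x₀ (by nlinarith) (pd_eq_zero_of_isMax hspace)).trans hlap
  have hder := (ht t₀ ht₀ x₀).hasDerivAt
  have hlim : Tendsto (slope (fun t => v t x₀) t₀) (𝓝[<] t₀)
      (𝓝 (deriv (fun t => v t x₀) t₀)) :=
    hder.tendsto_slope.mono_left (nhdsWithin_mono t₀ (fun s (hs : s < t₀) => hs.ne))
  have : ε ≤ deriv (fun t => v t x₀) t₀ := by
    refine ge_of_tendsto hlim ?_
    filter_upwards [Ioo_mem_nhdsLT ht₀] with s hs
    have h1 := hmax' s ⟨hs.1.le, hs.2.le.trans hmem.1.2⟩ x₀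
    rw [slope_comm, slope_def_field, le_div_iff₀ (sub_pos.2 hs.2)]
    linarith
  linarith

section periodic

variable {ι : Type*} [Finite ι] {F : ι → (Fin 3 → ℝ) → ℝ}

lemma exists_uniform_bound (hF : ∀ i, Continuous (F i))
    (hper : ∀ i x j, F i (x + Pi.single j (2 * Real.pi)) = F i x) :
    ∃ C, 0 ≤ C ∧ ∀ i x, |F i x| ≤ C := by
  choose C hC using fun i => exists_abs_le_of_periodic (hF i) (hper i)
  obtain ⟨D, hD⟩ := Finite.exists_le C
  exact ⟨max D 0, le_max_right _ _, fun i x =>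
    (hC i x).trans ((hD i).trans (le_max_left _ _))⟩

lemma exists_uniform_lipschitz (hF : ∀ i, ContDiff ℝ 1 (F i))
    (hper : ∀ i x j, F i (x + Pi.single j (2 * Real.pi)) = F i x) :
    ∃ C, 0 ≤ C ∧ ∀ i x h, |F i (x + h) - F i x| ≤ C * ‖h‖ := by
  obtain ⟨C, hC0, hC⟩ := exists_uniform_bound (F := fun i x => ‖fderiv ℝ (F i) x‖)
    (fun i => ((hF i).continuous_fderiv (by norm_num)).norm) (fun i x j => by
      rw [← fderiv_comp_add_right]; simp only [hper])
  refine ⟨C, hC0, fun i x h => ?_⟩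
  have := Convex.norm_image_sub_le_of_norm_fderiv_le (𝕜 := ℝ) (f := F i) (C := C) (s := univ)
    (x := x) (y := x + h) (fun y _ => (hF i).differentiable (by norm_num) y)
    (fun y _ => by simpa using hC i y) convex_univ (mem_univ _) (mem_univ _)
  simpa using this

end periodic

lemma lap_periodic {f : (Fin 3 → ℝ) → ℝ}
    (hper : ∀ x j, f (x + Pi.single j (2 * Real.pi)) = f x) (x : Fin 3 → ℝ) (j : Fin 3) :
    lap f (x + Pi.single j (2 * Real.pi)) = lap f x :=
  Finset.sum_congr rfl fun i _ => pd_periodic (pd_periodic hper i) i x j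

lemma contDiff_lap {f : (Fin 3 → ℝ) → ℝ} {n m : WithTop ℕ∞} (hf : ContDiff ℝ n f)
    (h : m + 1 + 1 ≤ n) : ContDiff ℝ m (lap f) :=
  ContDiff.sum fun j _ => contDiff_pd (contDiff_pd hf h j) le_rfl j

lemma pd_add {f g : (Fin 3 → ℝ) → ℝ} (hf : Differentiable ℝ f) (hg : Differentiable ℝ g)
    (j : Fin 3) : pd j (fun x => f x + g x) = fun x => pd j f x + pd j g x := by
  funext x
  simp [pd, fderiv_fun_add (hf x) (hg x)]

lemma lap_add {f g : (Fin 3 → ℝ) → ℝ} (hf : ContDiff ℝ 2 f) (hg : ContDiff ℝ 2 g) :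
    lap (fun x => f x + g x) = fun x => lap f x + lap g x := by
  funext x
  have h1 : ∀ {f : (Fin 3 → ℝ) → ℝ}, ContDiff ℝ 2 f → Differentiable ℝ f :=
    fun hf => hf.differentiable (by norm_num)
  have h2 : ∀ {f : (Fin 3 → ℝ) → ℝ}, ContDiff ℝ 2 f → ∀ j, Differentiable ℝ (pd j f) :=
    fun hf j => (contDiff_pd (m := 1) hf (by norm_num) j).differentiable (by norm_num)
  simp only [lap, pd_add (h1 hf) (h1 hg), pd_add (h2 hf _) (h2 hg _), Finset.sum_add_distrib]

lemma pd_neg (f : (Fin 3 → ℝ) → ℝ) (j : Fin 3) : pd j (fun x => -f x) = fun x => -pd j f x := by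
  funext x
  simp [pd, fderiv_fun_neg]

lemma lap_neg (f : (Fin 3 → ℝ) → ℝ) (x : Fin 3 → ℝ) : lap (fun x => -f x) x = -lap f x := by
  simp [lap, pd_neg]

lemma HasFDerivAt.pd_eq {f : (Fin 3 → ℝ) → ℝ} {c x : Fin 3 → ℝ}
    (h : HasFDerivAt f (dualOf c) x) (j : Fin 3) : pd j f x = c j := by
  rw [pd, h.fderiv, dualOf_single]

lemma contDiff_succ_of_hasFDerivAt_dualOf {f : (Fin 3 → ℝ) → ℝ} {D : (Fin 3 → ℝ) → Fin 3 → ℝ}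
    (hf : ∀ x, HasFDerivAt f (dualOf (D x)) x) {n : ℕ} (hD : ContDiff ℝ n D) :
    ContDiff ℝ (n + 1) f :=
  contDiff_succ_iff_hasFDerivAt.2 ⟨fun x => dualOf (D x), dualOf.contDiff.comp hD, hf⟩

namespace IsForcing

variable {g : ℝ → (Fin 3 → ℝ) → ℝ} {B a : ℝ}

lemma hasFDerivAt_duhamel_gaussKer (hg : IsForcing g B) (ha : 0 < a) (t : ℝ) (x : Fin 3 → ℝ) :
    HasFDerivAt (duhamel (weight a 0) gaussKer g t)
      (dualOf fun j => duhamel (weight a 1) (fun z => z j * gaussKer z) g t x) x := by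
  have h := hg.hasFDerivAt_duhamel (measurable_weight a 0) gaussianBounded_gaussKer
    gaussianBounded_apply_mul hasFDerivAt_gaussKer
    (duhamelBound_of_integrable hg.bound gaussianBounded_gaussKer ha zero_le_one)
    (fun j => by
      rw [← weight_succ a 0]
      exact duhamelBound_of_integrable hg.bound (gaussianBounded_apply_mul j) ha le_rfl) t x
  rwa [← weight_succ a 0] at h

lemma hasFDerivAt_duhamel_apply_mul (hg : IsForcing g B) (hL : LipschitzUpTo g) (ha : 0 < a)
    (j : Fin 3) (t : ℝ) (x : Fin 3 → ℝ) :
    HasFDerivAt (duhamel (weight a 1) (fun z => z j * gaussKer z) g t)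
      (dualOf fun i => duhamel (weight a 2) (fun z => hermiteTwo j i z * gaussKer z) g t x) x := by
  have h := hg.hasFDerivAt_duhamel (measurable_weight a 1) (gaussianBounded_apply_mul j)
    (gaussianBounded_hermiteTwo_mul j) (hasFDerivAt_apply_mul_gaussKer j)
    (duhamelBound_of_integrable hg.bound (gaussianBounded_apply_mul j) ha le_rfl)
    (fun i => by
      rw [← weight_succ a 1]
      exact duhamelBound_hermiteTwo hg hL ha j i) t x
  rwa [← weight_succ a 1] at h

lemma continuous_duhamel_hermiteTwo (hg : IsForcing g B) (hL : LipschitzUpTo g) (ha : 0 < a)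
    (j i : Fin 3) : Continuous fun p : ℝ × (Fin 3 → ℝ) =>
      duhamel (weight a 2) (fun z => hermiteTwo j i z * gaussKer z) g p.1 p.2 :=
  hg.continuous_duhamel (measurable_weight a 2) (gaussianBounded_hermiteTwo_mul j i)
    (duhamelBound_hermiteTwo hg hL ha j i)

lemma contDiff_duhamel (hg : IsForcing g B) (hL : LipschitzUpTo g) (ha : 0 < a) (t : ℝ) :
    ContDiff ℝ 2 (duhamel (weight a 0) gaussKer g t) := by
  refine contDiff_succ_of_hasFDerivAt_dualOf (n := 1)
    (fun x => hg.hasFDerivAt_duhamel_gaussKer ha t x) (contDiff_pi.2 fun j => ?_)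
  refine contDiff_succ_of_hasFDerivAt_dualOf (n := 0)
    (fun x => hg.hasFDerivAt_duhamel_apply_mul hL ha j t x) (contDiff_pi.2 fun i => ?_)
  exact contDiff_zero.2 ((hg.continuous_duhamel_hermiteTwo hL ha j i).comp
    (f := fun x => (t, x)) (by fun_prop))

lemma lap_duhamel (hg : IsForcing g B) (hL : LipschitzUpTo g) (ha : 0 < a) (t : ℝ)
    (x : Fin 3 → ℝ) : lap (duhamel (weight a 0) gaussKer g t) x =
      ∑ j, duhamel (weight a 2) (fun z => hermiteTwo j j z * gaussKer z) g t x := by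
  refine Finset.sum_congr rfl fun j _ => ?_
  have : (fun y => pd j (duhamel (weight a 0) gaussKer g t) y) =
      duhamel (weight a 1) (fun z => z j * gaussKer z) g t :=
    funext fun y => (hg.hasFDerivAt_duhamel_gaussKer ha t y).pd_eq j
  rw [this]
  exact (hg.hasFDerivAt_duhamel_apply_mul hL ha j t x).pd_eq j

end IsForcing

/-- Truncation of a real number to the interval `[-M, M]`. -/
def clip (M x : ℝ) : ℝ := max (-M) (min M x)

lemma abs_clip_le {M : ℝ} (hM : 0 ≤ M) (x : ℝ) : |clip M x| ≤ M :=
  abs_le.2 ⟨le_max_left _ _, max_le (by linarith) (min_le_left _ _)⟩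

lemma abs_clip_sub_clip_le (M x y : ℝ) : |clip M x - clip M y| ≤ |x - y| := by
  have := ((LipschitzWith.id.const_min M).const_max (-M)).dist_le_mul x y
  simpa [Real.dist_eq, clip] using this

lemma clip_of_abs_le {M x : ℝ} (h : |x| ≤ M) : clip M x = x := by
  rw [clip, min_eq_right (abs_le.1 h).2, max_eq_right (abs_le.1 h).1]

lemma clip_of_le {M x : ℝ} (hM : 0 ≤ M) (h : M ≤ x) : clip M x = M := by
  rw [clip, min_eq_left h, max_eq_right (by linarith)]

lemma clip_of_le_neg {M x : ℝ} (hM : 0 ≤ M) (h : x ≤ -M) : clip M x = -M := by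
  rw [clip, min_eq_right (by linarith), max_eq_left h]

@[fun_prop]
lemma continuous_clip (M : ℝ) : Continuous (clip M) := by unfold clip; fun_prop

/-- The truncated and damped Burgers nonlinearity. -/
def reaction (a M K : ℝ) (Z : Jet) (i : Fin 3) : ℝ :=
  a * clip M (Z i none) - ∑ j, clip M (Z j none) * clip K (Z i (some j))

section reaction

variable {a M K : ℝ}

lemma continuous_reaction (a M K : ℝ) (i : Fin 3) : Continuous fun Z => reaction a M K Z i := by
  unfold reaction; fun_prop

lemma abs_reaction_le (ha : 0 ≤ a) (hM : 0 ≤ M) (hK : 0 ≤ K) (Z : Jet) (i : Fin 3) :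
    |reaction a M K Z i| ≤ a * M + 3 * (M * K) := by
  refine (abs_sub _ _).trans (add_le_add ?_ ?_)
  · rw [abs_mul, abs_of_nonneg ha]
    exact mul_le_mul_of_nonneg_left (abs_clip_le hM _) ha
  · refine (Finset.abs_sum_le_sum_abs _ _).trans ((Finset.sum_le_card_nsmul _ _ (M * K)
      fun j _ => ?_).trans_eq (by simp))
    rw [abs_mul]
    exact mul_le_mul (abs_clip_le hM _) (abs_clip_le hK _) (abs_nonneg _) hM

lemma abs_reaction_sub_le (ha : 0 ≤ a) (hM : 0 ≤ M) (hK : 0 ≤ K) (Z Z' : Jet) (i : Fin 3) :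
    |reaction a M K Z i - reaction a M K Z' i| ≤ (a + 3 * (M + K)) * ‖Z - Z'‖ := by
  have hcomp : ∀ i m, |Z i m - Z' i m| ≤ ‖Z - Z'‖ := fun i m =>
    (norm_le_pi_norm ((Z - Z') i) m).trans (norm_le_pi_norm (Z - Z') i)
  have hclip : ∀ (R : ℝ) i m, |clip R (Z i m) - clip R (Z' i m)| ≤ ‖Z - Z'‖ := fun R i m =>
    (abs_clip_sub_clip_le R _ _).trans (hcomp i m)
  have h1 : |a * (clip M (Z i none) - clip M (Z' i none))| ≤ a * ‖Z - Z'‖ := by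
    rw [abs_mul, abs_of_nonneg ha]
    exact mul_le_mul_of_nonneg_left (hclip M i none) ha
  have h2 : |∑ j, (clip M (Z j none) * clip K (Z i (some j))
      - clip M (Z' j none) * clip K (Z' i (some j)))| ≤ 3 * ((M + K) * ‖Z - Z'‖) := by
    refine (Finset.abs_sum_le_sum_abs _ _).trans ((Finset.sum_le_card_nsmul _ _
      ((M + K) * ‖Z - Z'‖) fun j _ => ?_).trans_eq (by simp))
    have h3 : clip M (Z j none) * clip K (Z i (some j))
        - clip M (Z' j none) * clip K (Z' i (some j)) =
        clip M (Z j none) * (clip K (Z i (some j)) - clip K (Z' i (some j))) +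
        (clip M (Z j none) - clip M (Z' j none)) * clip K (Z' i (some j)) := by ring
    rw [h3, add_mul]
    refine (abs_add_le _ _).trans (add_le_add ?_ ?_)
    · rw [abs_mul]
      exact mul_le_mul (abs_clip_le hM _) (hclip K i (some j)) (abs_nonneg _) hM
    · rw [abs_mul, mul_comm K]
      exact mul_le_mul (hclip M j none) (abs_clip_le hK _) (abs_nonneg _) (norm_nonneg _)
  have h4 : reaction a M K Z i - reaction a M K Z' i =
      a * (clip M (Z i none) - clip M (Z' i none)) -
      ∑ j, (clip M (Z j none) * clip K (Z i (some j))
        - clip M (Z' j none) * clip K (Z' i (some j))) := by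
    simp only [reaction, Finset.sum_sub_distrib]; ring
  rw [h4]
  refine (abs_sub _ _).trans ((add_le_add h1 h2).trans_eq (by ring))

end reaction

/-- The jet of the initial data. -/
noncomputable def initialJet (f : Fin 3 → (Fin 3 → ℝ) → ℝ) (x : Fin 3 → ℝ) : Jet
  | i, none => f i x
  | i, some j => pd j (f i) x

/-- The nonlinearity of the truncated equation for the difference to the initial data. -/
noncomputable def truncatedForcing (f : Fin 3 → (Fin 3 → ℝ) → ℝ) (a M K : ℝ) (x : Fin 3 → ℝ)
    (y : Jet) (i : Fin 3) : ℝ :=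
  reaction a M K (initialJet f x + y) i + lap (f i) x - a * f i x

section truncated

variable {f : Fin 3 → (Fin 3 → ℝ) → ℝ} {a M K : ℝ}

lemma continuous_truncatedForcing (hf : ∀ i, ContDiff ℝ 3 (f i)) (a M K : ℝ) :
    Continuous fun p : (Fin 3 → ℝ) × Jet => truncatedForcing f a M K p.1 p.2 := by
  refine continuous_pi fun i => ?_
  have h0 := fun i => (hf i).continuous
  have h1 : Continuous (initialJet f) := by
    refine continuous_pi fun i => continuous_pi fun m => ?_
    cases m with
    | none => exact h0 i
    | some j => exact (contDiff_pd (m := 0) (hf i) (by norm_num) j).continuous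
  have h2 : Continuous (lap (f i)) :=
    (contDiff_lap (m := 0) (hf i) (by norm_num)).continuous
  unfold truncatedForcing
  exact (((continuous_reaction a M K i).comp (f := fun p : (Fin 3 → ℝ) × Jet =>
    initialJet f p.1 + p.2) (by fun_prop)).add (h2.comp continuous_fst)).sub
      (continuous_const.mul ((h0 i).comp continuous_fst))

lemma norm_truncatedForcing_le (ha : 0 ≤ a) (hM : 0 ≤ M) (hK : 0 ≤ K)
    (hfM : ∀ i x, |f i x| ≤ M) {B : ℝ} (hB : ∀ i x, |lap (f i) x| ≤ B) (x : Fin 3 → ℝ) (y : Jet) :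
    ‖truncatedForcing f a M K x y‖ ≤ a * M + 3 * (M * K) + B + a * M := by
  have hB0 : 0 ≤ B := (abs_nonneg _).trans (hB 0 0)
  refine (pi_norm_le_iff_of_nonneg (by positivity)).2 fun i => ?_
  refine (abs_sub _ _).trans (add_le_add ((abs_add_le _ _).trans
    (add_le_add (abs_reaction_le ha hM hK _ _) (hB i x))) ?_)
  rw [abs_mul, abs_of_nonneg ha]
  exact mul_le_mul_of_nonneg_left (hfM i x) ha

lemma norm_truncatedForcing_sub_le (ha : 0 ≤ a) (hM : 0 ≤ M) (hK : 0 ≤ K) (x : Fin 3 → ℝ)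
    (y y' : Jet) : ‖truncatedForcing f a M K x y - truncatedForcing f a M K x y'‖ ≤
      (a + 3 * (M + K)) * ‖y - y'‖ := by
  refine (pi_norm_le_iff_of_nonneg (by positivity)).2 fun i => ?_
  have := abs_reaction_sub_le ha hM hK (initialJet f x + y) (initialJet f x + y') i
  rw [add_sub_add_left_eq_sub] at this
  simpa [truncatedForcing] using this

lemma exists_truncatedForcing_lipschitz (hf : ∀ i, ContDiff ℝ 3 (f i))
    (hper : ∀ i x j, f i (x + Pi.single j (2 * Real.pi)) = f i x)
    (ha : 0 ≤ a) (hM : 0 ≤ M) (hK : 0 ≤ K) :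
    ∃ C, 0 ≤ C ∧ ∀ x h y,
      ‖truncatedForcing f a M K (x + h) y - truncatedForcing f a M K x y‖ ≤ C * ‖h‖ := by
  obtain ⟨C₀, hC₀, h₀⟩ := exists_uniform_lipschitz
    (fun i => (hf i).of_le (by norm_num)) hper
  obtain ⟨C₁, hC₁, h₁⟩ := exists_uniform_lipschitz (F := fun (p : Fin 3 × Fin 3) => pd p.2 (f p.1))
    (fun p => contDiff_pd (hf p.1) (by norm_num) p.2)
    (fun p x j => pd_periodic (hper p.1) p.2 x j)
  obtain ⟨C₂, hC₂, h₂⟩ := exists_uniform_lipschitz (F := fun i => lap (f i))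
    (fun i => contDiff_lap (hf i) (by norm_num)) (fun i x j => lap_periodic (hper i) x j)
  refine ⟨(a + 3 * (M + K)) * (C₀ + C₁) + C₂ + a * C₀, by positivity, fun x h y => ?_⟩
  refine (pi_norm_le_iff_of_nonneg (by positivity)).2 fun i => ?_
  have hjet : ‖initialJet f (x + h) - initialJet f x‖ ≤ (C₀ + C₁) * ‖h‖ := by
    refine (pi_norm_le_iff_of_nonneg (by positivity)).2 fun i =>
      (pi_norm_le_iff_of_nonneg (by positivity)).2 fun m => ?_
    have h3 := mul_nonneg hC₀ (norm_nonneg h)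
    have h4 := mul_nonneg hC₁ (norm_nonneg h)
    cases m with
    | none =>
      refine (h₀ i x h).trans ?_
      linarith
    | some j =>
      refine (h₁ (i, j) x h).trans ?_
      linarith
  have hr := abs_reaction_sub_le ha hM hK (initialJet f (x + h) + y) (initialJet f x + y) i
  rw [add_sub_add_right_eq_sub] at hr
  have hr' := hr.trans (mul_le_mul_of_nonneg_left hjet (by positivity))
  have h5 : |a * (f i (x + h) - f i x)| ≤ a * (C₀ * ‖h‖) := by
    rw [abs_mul, abs_of_nonneg ha]
    exact mul_le_mul_of_nonneg_left (h₀ i x h) ha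
  have h6 : (truncatedForcing f a M K (x + h) y - truncatedForcing f a M K x y) i =
      (reaction a M K (initialJet f (x + h) + y) i - reaction a M K (initialJet f x + y) i) +
      (lap (f i) (x + h) - lap (f i) x) - a * (f i (x + h) - f i x) := by
    simp only [truncatedForcing, Pi.sub_apply]; ring
  rw [Real.norm_eq_abs, h6]
  refine (abs_sub _ _).trans ((add_le_add ((abs_add_le _ _).trans
    (add_le_add hr' (h₂ i x h))) h5).trans_eq (by ring))

lemma truncatedForcing_periodic
    (hper : ∀ i x j, f i (x + Pi.single j (2 * Real.pi)) = f i x) (x : Fin 3 → ℝ) (j : Fin 3)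
    (y : Jet) : truncatedForcing f a M K (x + Pi.single j (2 * Real.pi)) y =
      truncatedForcing f a M K x y := by
  have : initialJet f (x + Pi.single j (2 * Real.pi)) = initialJet f x := by
    funext i m
    cases m with
    | none => exact hper i x j
    | some l => exact pd_periodic (hper i) l x j
  funext i
  simp only [truncatedForcing, this, hper, lap_periodic (hper i)]

end truncated

/-- Solvability of the Burgers equations with truncated nonlinearity and damping. -/
theorem exists_truncated_solution {f : Fin 3 → (Fin 3 → ℝ) → ℝ} (hf : ∀ i, ContDiff ℝ 3 (f i))
    (hper : ∀ i x j, f i (x + Pi.single j (2 * Real.pi)) = f i x) {a M K A B : ℝ} (ha : 0 < a)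
    (hM : 0 ≤ M) (hK : 0 ≤ K) (hfM : ∀ i x, |f i x| ≤ M) (hA : ∀ i j x, |pd j (f i) x| ≤ A)
    (hB : ∀ i x, |lap (f i) x| ≤ B) :
    ∃ v : Fin 3 → ℝ → (Fin 3 → ℝ) → ℝ,
      (∀ i, Continuous fun p : ℝ × (Fin 3 → ℝ) => v i p.1 p.2) ∧
      (∀ i t x j, v i t (x + Pi.single j (2 * Real.pi)) = v i t x) ∧
      (∀ i x, v i 0 x = f i x) ∧
      (∀ i t, ContDiff ℝ 2 (v i t)) ∧
      (∀ i x, Continuous fun t => lap (v i t) x) ∧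
      (∀ i j x, Continuous fun t => pd j (v i t) x) ∧
      (∀ i t x j, |pd j (v i t) x| ≤ A + (∫ τ in Ioi 0, weight a 1 τ) *
        (∫ z, |z j * gaussKer z|) * (a * M + 3 * (M * K) + B + a * M)) ∧
      ∀ i, ∀ t > 0, ∀ x, HasDerivAt (fun t => v i t x)
        (lap (v i t) x - a * (v i t x - clip M (v i t x))
          - ∑ j, clip M (v j t x) * clip K (pd j (v i t) x)) t := by
  set N := truncatedForcing f a M K with hN
  set D := a * M + 3 * (M * K) + B + a * M with hD
  have hNc : Continuous fun p : (Fin 3 → ℝ) × Jet => N p.1 p.2 :=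
    continuous_truncatedForcing hf a M K
  have hNB : ∀ x y, ‖N x y‖ ≤ D := norm_truncatedForcing_le ha.le hM hK hfM hB
  have hNL : ∀ x y y', ‖N x y - N x y'‖ ≤ (a + 3 * (M + K)) * ‖y - y'‖ :=
    norm_truncatedForcing_sub_le ha.le hM hK
  obtain ⟨C, hC, hNC⟩ := exists_truncatedForcing_lipschitz hf hper ha.le hM hK
  obtain ⟨ν, hν, W, hWc, hW, hWh⟩ := exists_duhamel_fixedPoint hNc hNB (by positivity) hNL ha
  set g : Fin 3 → ℝ → (Fin 3 → ℝ) → ℝ := fun i s x => if 0 < s then N x (W s x) i else 0 with hgdef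
  have hg : ∀ i, IsForcing (g i) D := fun i => by
    have h := isForcing_scaledForcing hNc hNB le_rfl hWc i
    have : scaledForcing N 0 (fun p : ℝ × (Fin 3 → ℝ) => W p.1 p.2) i = g i := by
      funext s x; simp [scaledForcing, hgdef]
    rwa [this] at h
  have hLip : ∀ i, LipschitzUpTo (g i) := fun i T => by
    refine ⟨C + (a + 3 * (M + K)) * (C * exp (ν * T)), by positivity, fun s hs x h => ?_⟩
    simp only [hgdef]
    split_ifs with h0
    · have h1 := hWh h (C * ‖h‖) (by positivity) (fun x y => hNC x h y) s x
      have h2 : exp (ν * s) ≤ exp (ν * T) := exp_le_exp.2 (by nlinarith)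
      have h3 : C * ‖h‖ * exp (ν * s) ≤ C * exp (ν * T) * ‖h‖ := by
        rw [mul_right_comm]
        exact mul_le_mul_of_nonneg_right (mul_le_mul_of_nonneg_left h2 hC) (norm_nonneg _)
      refine (norm_le_pi_norm (N (x + h) (W s (x + h)) - N x (W s x)) i).trans ?_
      refine (norm_sub_le_norm_sub_add_norm_sub _ (N x (W s (x + h))) _).trans ?_
      refine (add_le_add (hNC x h _) ((hNL _ _ _).trans
        (mul_le_mul_of_nonneg_left (h1.trans h3) (by positivity)))).trans_eq (by ring)
    · simp only [sub_zero, abs_zero]; positivity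
  have hw : ∀ i t, duhamel (weight a 0) gaussKer (g i) t = fun x => W t x i none :=
    fun i t => funext fun x => (hW t x i none).symm
  have hf1 : ∀ i, Differentiable ℝ (f i) := fun i => (hf i).differentiable (by norm_num)
  have hf2 : ∀ i, ContDiff ℝ 2 (f i) := fun i => (hf i).of_le (by norm_num)
  have hW2 : ∀ i t, ContDiff ℝ 2 fun x => W t x i none := fun i t => by
    rw [← hw]; exact (hg i).contDiff_duhamel (hLip i) ha t
  have hpd : ∀ i t x j, pd j (fun x => f i x + W t x i none) x =
      pd j (f i) x + W t x i (some j) := fun i t x j => by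
    rw [pd_add (hf1 i) ((hW2 i t).differentiable (by norm_num)), hW t x i (some j), ← hw]
    exact congrArg _ (((hg i).hasFDerivAt_duhamel_gaussKer ha t x).pd_eq j)
  have hlap : ∀ i t x, lap (fun x => f i x + W t x i none) x =
      lap (f i) x + lap (fun x => W t x i none) x := fun i t x => by
    rw [lap_add (hf2 i) (hW2 i t)]
  have hWx : ∀ i m x, Continuous fun t => W t x i m := fun i m x =>
    (continuous_apply_apply i m).comp (hWc.comp (f := fun t => (t, x)) (by fun_prop))
  refine ⟨fun i t x => f i x + W t x i none, fun i => ?_, fun i t x j => ?_, fun i x => ?_,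
    fun i t => (hf2 i).add (hW2 i t), fun i x => ?_, fun i j x => ?_, fun i t x j => ?_,
    fun i t ht x => ?_⟩
  · exact ((hf i).continuous.comp continuous_snd).add ((continuous_apply_apply i none).comp hWc)
  · have h := hWh (Pi.single j (2 * Real.pi)) 0 le_rfl
      (fun x y => by rw [hN, truncatedForcing_periodic hper]; simp) t x
    rw [zero_mul, norm_le_zero_iff, sub_eq_zero] at h
    simp only [hper, h]
  · have : W 0 x i none = 0 := by
      rw [← congrFun (hw i 0) x, duhamel]
      refine setIntegral_eq_zero_of_forall_eq_zero fun τ hτ => ?_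
      have h : ∀ y, g i (0 - τ) y = 0 := (hg i).zero _ (by linarith [mem_Ioi.1 hτ])
      simp only [heatAvg, h, mul_zero, integral_zero]
    simp only [this, add_zero]
  · simp only [hlap, ← hw, (hg i).lap_duhamel (hLip i) ha]
    refine continuous_const.add (continuous_finsetSum _ fun j _ => ?_)
    exact ((hg i).continuous_duhamel_hermiteTwo (hLip i) ha j j).comp
      (f := fun t => (t, x)) (by fun_prop)
  · simp only [hpd]
    exact continuous_const.add (hWx i (some j) x)
  · rw [hpd]
    refine (abs_add_le _ _).trans (add_le_add (hA i j x) ?_)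
    rw [hW]
    exact abs_duhamel_le (hg i).bound (gaussianBounded_apply_mul j) ha le_rfl t x
  · have h := ((hg i).hasDerivAt_duhamel (hLip i) ha x ht).const_add (f i x)
    rw [← (hg i).lap_duhamel (hLip i) ha] at h
    simp only [hw] at h
    refine h.congr_deriv ?_
    simp only [hgdef, if_pos ht, hN, truncatedForcing, reaction, hlap, hpd, Pi.add_apply,
      initialJet]
    ring

/-- Solutions of the truncated equations satisfy the maximum principle. -/
lemma abs_le_of_truncated {v : Fin 3 → ℝ → (Fin 3 → ℝ) → ℝ} {a M K : ℝ} (ha : 0 < a) (hM : 0 ≤ M)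
    (hK : 0 ≤ K) (hc : ∀ i, Continuous fun p : ℝ × (Fin 3 → ℝ) => v i p.1 p.2)
    (hper : ∀ i t x j, v i t (x + Pi.single j (2 * Real.pi)) = v i t x)
    (h0 : ∀ i x, |v i 0 x| ≤ M) (hC : ∀ i t, ContDiff ℝ 2 (v i t))
    (hd : ∀ i, ∀ t > 0, ∀ x, HasDerivAt (fun t => v i t x)
      (lap (v i t) x - a * (v i t x - clip M (v i t x))
        - ∑ j, clip M (v j t x) * clip K (pd j (v i t) x)) t) (i : Fin 3) :
    ∀ t ≥ 0, ∀ x, |v i t x| ≤ M := by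
  have hK0 : clip K 0 = 0 := clip_of_abs_le (by simpa using hK)
  have hup := le_of_forall_deriv_le_lap (hc i).continuousOn (hper i)
    (fun x => (abs_le.1 (h0 i x)).2) (fun t ht x => (hd i t ht x).differentiableAt)
    (fun t _ => hC i t) (fun t ht x hMx hpd => by
      rw [(hd i t ht x).deriv, clip_of_le hM hMx.le]
      simp only [hpd, hK0, mul_zero, Finset.sum_const_zero, sub_zero]
      nlinarith)
  have hdown := le_of_forall_deriv_le_lap (v := fun t x => -v i t x) (hc i).neg.continuousOn
    (fun t x j => by rw [hper])
    (fun x => neg_le.1 (abs_le.1 (h0 i x)).1) (fun t ht x => (hd i t ht x).neg.differentiableAt)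
    (fun t _ => (hC i t).neg) (fun t ht x hMx hpd => by
      have hpd' : ∀ j, pd j (v i t) x = 0 := fun j => by
        have := hpd j
        rwa [pd_neg, neg_eq_zero] at this
      rw [(hd i t ht x).fun_neg.deriv, lap_neg, clip_of_le_neg hM (by linarith)]
      simp only [hpd', hK0, mul_zero, Finset.sum_const_zero, sub_zero]
      nlinarith)
  exact fun t ht x => abs_le.2 ⟨by linarith [hdown t ht x], hup t ht x⟩

/-- Global existence of classical solutions of the diffusive Burgers equations for smooth
`2π`-periodic initial data: there is a function `u`, continuous on `[0,∞) × ℝ³`, periodic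
in space, attaining the initial data at `t = 0`, which for positive times is `C¹` in time,
`C²` in space and satisfies the Burgers equations pointwise. -/
theorem burgers_global_existence
    (u₀ : (Fin 3 → ℝ) → (Fin 3 → ℝ))
    (h₀sm : ContDiff ℝ (⊤ : ℕ∞) u₀)
    (h₀per : ∀ (x : Fin 3 → ℝ) (j : Fin 3), u₀ (x + Pi.single j (2 * Real.pi)) = u₀ x) :
    ∃ u : ℝ → (Fin 3 → ℝ) → (Fin 3 → ℝ),
      ContinuousOn (fun p : ℝ × (Fin 3 → ℝ) => u p.1 p.2) (Set.Ici 0 ×ˢ Set.univ) ∧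
      (∀ (t : ℝ) (x : Fin 3 → ℝ) (j : Fin 3), u t (x + Pi.single j (2 * Real.pi)) = u t x) ∧
      (∀ x : Fin 3 → ℝ, u 0 x = u₀ x) ∧
      (∀ (x : Fin 3 → ℝ) (i : Fin 3), ContDiffOn ℝ 1 (fun t => u t x i) (Set.Ioi 0)) ∧
      (∀ t : ℝ, 0 < t → ∀ i : Fin 3, ContDiff ℝ 2 (fun x => u t x i)) ∧
      (∀ t : ℝ, 0 < t → ∀ (x : Fin 3 → ℝ) (i : Fin 3),
        deriv (fun s => u s x i) t + ∑ j, u t x j * pd j (fun y => u t y i) x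
          - lap (fun y => u t y i) x = 0) := by
  have hf : ∀ i, ContDiff ℝ 3 fun x => u₀ x i := fun i =>
    (contDiff_infty.1 (contDiff_pi.1 h₀sm i)) 3
  have hper : ∀ i x j, u₀ (x + Pi.single j (2 * Real.pi)) i = u₀ x i := fun i x j => by
    rw [h₀per]
  obtain ⟨M, hM, hfM⟩ := exists_uniform_bound (fun i => (hf i).continuous) hper
  obtain ⟨A, hA0, hA⟩ := exists_uniform_bound
    (F := fun (p : Fin 3 × Fin 3) => pd p.2 (fun x => u₀ x p.1))
    (fun p => (contDiff_pd (m := 2) (hf p.1) (by norm_num) p.2).continuous)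
    (fun p x j => pd_periodic (hper p.1) p.2 x j)
  obtain ⟨B, hB0, hB⟩ := exists_uniform_bound (F := fun i => lap (fun x => u₀ x i))
    (fun i => (contDiff_lap (m := 1) (hf i) (by norm_num)).continuous)
    (fun i x j => lap_periodic (hper i) x j)
  set θ : ℝ := 1 / (6 * M + 1) with hθ
  have hθ0 : 0 < θ := by positivity
  have hθM : θ * (6 * M + 1) = 1 := by rw [hθ]; field_simp
  obtain ⟨b, hb⟩ := exists_forall_duhamel_norm_le hθ0
  set a := max b 1
  have ha : 0 < a := lt_of_lt_of_le one_pos (le_max_right _ _)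
  set K := 2 * (A + θ * (2 * (a * M) + B)) with hKdef
  have hK : 0 ≤ K := by positivity
  obtain ⟨v, hvc, hvper, hv0, hvC, hvlap, hvpd, hvK, hvd⟩ :=
    exists_truncated_solution hf hper ha hM hK hfM (fun i j x => hA (i, j) x) hB
  have hvM := abs_le_of_truncated ha hM hK hvc hvper
    (fun i x => by rw [hv0]; exact hfM i x) hvC hvd
  have hvK' : ∀ i t x j, |pd j (v i t) x| ≤ K := fun i t x j => by
    have h2 := hb a (le_max_left _ _) (some j)
    have h3 := mul_le_mul_of_nonneg_right h2
      (by positivity : 0 ≤ a * M + 3 * (M * K) + B + a * M)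
    refine (hvK i t x j).trans ((add_le_add le_rfl h3).trans ?_)
    have h4 : θ * M * 6 ≤ 1 := by linarith
    have h5 : θ * M * 6 * K ≤ 1 * K := mul_le_mul_of_nonneg_right h4 hK
    linarith
  refine ⟨fun t x i => v i t x, (continuous_pi fun i => hvc i).continuousOn,
    fun t x j => funext fun i => hvper i t x j, fun x => funext fun i => hv0 i x, fun x i => ?_,
    fun t _ i => hvC i t, fun t ht x i => ?_⟩
  · have hcont : Continuous fun t => lap (v i t) x - a * (v i t x - clip M (v i t x))
        - ∑ j, clip M (v j t x) * clip K (pd j (v i t) x) := by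
      have h1 := hvlap i x
      have h2 := fun j => hvpd i j x
      have h3 : ∀ i, Continuous fun t => v i t x := fun i =>
        (hvc i).comp (f := fun t => (t, x)) (by fun_prop)
      fun_prop
    rw [show (1 : WithTop ℕ∞) = 0 + 1 from rfl, contDiffOn_succ_iff_deriv_of_isOpen isOpen_Ioi]
    refine ⟨fun t ht => (hvd i t ht x).differentiableAt.differentiableWithinAt, by simp, ?_⟩
    exact contDiffOn_zero.2 (hcont.continuousOn.congr fun t ht => (hvd i t ht x).deriv)
  · simp only [(hvd i t ht x).deriv, clip_of_abs_le (hvM _ t ht.le x),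
      clip_of_abs_le (hvK' i t x _)]
    ring
end
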